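/- arXiv:math/0306108 — 4 statements merged into one kernel-verified Lean document; each statement's English description precedes it below -/
import Mathlib

section
/- Let λ₀ > 0, let χ : ℝ → ℝ be a smooth function with χ(λ) = 0 for λ ≤ λ₀ and χ(λ) = 1 for λ ≥ 2λ₀ and 0 ≤ χ ≤ 1, and let φ : ℝ → ℝ be smooth with φ(λ) = 1 for |λ| ≤ 1 and φ(λ) = 0 for |λ| ≥ 2. For L ≥ 1 set χ_L(λ) = χ(λ)φ(λ/L). Then there is a constant C, depending only on χ, φ and λ₀, such that for every integer n ≥ 0 and every L ≥ 1 the function G_{n,L}(ξ) = ∫_ℝ χ_L(λ²) λ^{-n} λ₀^{n/2} e^{-iλξ} dλ satisfies ∫_ℝ |G_{n,L}(ξ)| dξ ≤ C(1+n). -/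
open MeasureTheory

open FourierTransform in
theorem aux_L2 (f : ℝ → ℝ) (hf : ContDiff ℝ (⊤ : ℕ∞) f) (hc : HasCompactSupport f)
    (A B R : ℝ) (hR : 0 < R) (hA : ∀ x, f x ^ 2 ≤ A * (1 + x ^ 2)⁻¹)
    (hB : ∀ x, deriv f x ^ 2 ≤ B * (1 + x ^ 2)⁻¹) :
    Integrable (fun ξ : ℝ => ‖∫ l : ℝ, ((f l : ℝ) : ℂ) * Complex.exp (-(Complex.I * l * ξ))‖) ∧
    ∫ ξ : ℝ, ‖∫ l : ℝ, ((f l : ℝ) : ℂ) * Complex.exp (-(Complex.I * l * ξ))‖ ≤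
      2 * Real.pi * (Real.pi * (1 + R * A + B / R)) := by
  set F : ℝ → ℂ := fun x => (f x : ℂ) with hF
  have hFs : ContDiff ℝ (⊤ : ℕ∞) F := Complex.ofRealCLM.contDiff.comp hf
  have hFc : HasCompactSupport F := hc.comp_left (g := fun x : ℝ => (x : ℂ)) (by simp)
  have hF' : deriv F = fun x => ((deriv f x : ℝ) : ℂ) := by
    funext x
    exact ((hf.differentiable (by simp)).differentiableAt.hasDerivAt.ofReal_comp).deriv
  have hFs' : ContDiff ℝ (⊤ : ℕ∞) (deriv F) := by
    have := (contDiff_infty_iff_deriv (f := F)).1 hFs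
    exact this.2
  have hFc' : HasCompactSupport (deriv F) := hFc.deriv
  have hG : ∀ ξ : ℝ, (∫ l : ℝ, ((f l : ℝ) : ℂ) * Complex.exp (-(Complex.I * l * ξ)))
      = 𝓕 F (ξ / (2 * Real.pi)) := by
    intro ξ
    rw [Real.fourier_real_eq_integral_exp_smul]
    congr 1
    funext l
    rw [smul_eq_mul, mul_comm]
    congr 2
    have := Real.pi_ne_zero
    push_cast
    field_simp
  simp_rw [hG]
  let S := hFc.toSchwartzMap hFs
  let S' := hFc'.toSchwartzMap hFs'
  have hS : ∀ x, S x = F x := fun x => rfl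
  have hSf : (S : ℝ → ℂ) = F := rfl
  have hSf' : (S' : ℝ → ℂ) = deriv F := rfl
  have e1 : ∫ x, ‖𝓕 F x‖ ^ 2 = ∫ x, f x ^ 2 := by
    have := S.integral_norm_sq_fourier
    rw [SchwartzMap.fourier_coe, hSf] at this
    rw [this]; simp [hF]
  have e2 : ∫ x, ‖𝓕 (deriv F) x‖ ^ 2 = ∫ x, deriv f x ^ 2 := by
    have := S'.integral_norm_sq_fourier
    rw [SchwartzMap.fourier_coe, hSf'] at this
    rw [this]; simp [hF']
  have i1 : Integrable (fun x => ‖𝓕 F x‖ ^ 2) := by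
    have := (𝓕 S).memLp 2 (volume : Measure ℝ)
    rw [SchwartzMap.fourier_coe, hSf] at this
    exact this.integrable_norm_pow (by norm_num)
  have i2 : Integrable (fun x => ‖𝓕 (deriv F) x‖ ^ 2) := by
    have := (𝓕 S').memLp 2 (volume : Measure ℝ)
    rw [SchwartzMap.fourier_coe, hSf'] at this
    exact this.integrable_norm_pow (by norm_num)
  have i0 : Integrable (fun x => ‖𝓕 F x‖) := by
    have := (𝓕 S).integrable (μ := (volume : Measure ℝ))
    rw [SchwartzMap.fourier_coe, hSf] at this
    exact this.norm
  have hpi := Real.pi_pos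
  have hd : ∀ x, ‖𝓕 (deriv F) x‖ = 2 * Real.pi * |x| * ‖𝓕 F x‖ := by
    intro x
    rw [Real.fourier_deriv (hFs.continuous.integrable_of_hasCompactSupport hFc)
      (hFs.differentiable (by simp)) (hFs'.continuous.integrable_of_hasCompactSupport hFc')]
    simp [abs_of_pos hpi]
  have b1 : ∫ x, f x ^ 2 ≤ A * Real.pi := by
    rw [← integral_univ_inv_one_add_sq, ← integral_const_mul]
    refine integral_mono_of_nonneg (Filter.Eventually.of_forall fun x => sq_nonneg _)
      (integrable_inv_one_add_sq.const_mul A) (Filter.Eventually.of_forall hA)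
  have b2 : ∫ x, deriv f x ^ 2 ≤ B * Real.pi := by
    rw [← integral_univ_inv_one_add_sq, ← integral_const_mul]
    refine integral_mono_of_nonneg (Filter.Eventually.of_forall fun x => sq_nonneg _)
      (integrable_inv_one_add_sq.const_mul B) (Filter.Eventually.of_forall hB)
  have i3 : Integrable (fun x : ℝ => (1 + (x / R) ^ 2)⁻¹) :=
    integrable_inv_one_add_sq.comp_div hR.ne'
  have e3 : ∫ x : ℝ, (1 + (x / R) ^ 2)⁻¹ = R * Real.pi := by
    rw [Measure.integral_comp_div (fun x : ℝ => (1 + x ^ 2)⁻¹) R, integral_univ_inv_one_add_sq,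
      abs_of_pos hR, smul_eq_mul]
  have key : ∫ x, ‖𝓕 F x‖ ≤ Real.pi * (1 + R * A + B / R) := by
    have hpt : ∀ x, ‖𝓕 F x‖ ≤ R⁻¹ * (1 + (x / R) ^ 2)⁻¹
        + (R * ‖𝓕 F x‖ ^ 2 + R⁻¹ * ‖𝓕 (deriv F) x‖ ^ 2) := by
      intro x
      rw [hd]
      set y := ‖𝓕 F x‖
      have hy : 0 ≤ y := norm_nonneg _
      have h1 : R⁻¹ * (1 + (x / R) ^ 2)⁻¹ = R * (R ^ 2 + x ^ 2)⁻¹ := by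
        field_simp
      have h2 : R * y ^ 2 + R⁻¹ * (2 * Real.pi * |x| * y) ^ 2 ≥ R⁻¹ * (R ^ 2 + x ^ 2) * y ^ 2 := by
        have : (2 * Real.pi * |x| * y) ^ 2 = (2 * Real.pi) ^ 2 * (x ^ 2 * y ^ 2) := by
          rw [mul_pow, mul_pow, sq_abs]; ring
        rw [this]
        have h3 : (1 : ℝ) ≤ (2 * Real.pi) ^ 2 := by nlinarith [Real.pi_gt_three]
        have h4 : x ^ 2 * y ^ 2 ≤ (2 * Real.pi) ^ 2 * (x ^ 2 * y ^ 2) :=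
          le_mul_of_one_le_left (by positivity) h3
        have h5 := mul_le_mul_of_nonneg_left h4 (inv_pos.2 hR).le
        have h6 : R⁻¹ * (R ^ 2 + x ^ 2) * y ^ 2 = R * y ^ 2 + R⁻¹ * (x ^ 2 * y ^ 2) := by
          field_simp
        linarith
      rw [h1]
      have hq : 0 < R ^ 2 + x ^ 2 := by positivity
      have h7 : y ≤ R * (R ^ 2 + x ^ 2)⁻¹ + R⁻¹ * (R ^ 2 + x ^ 2) * y ^ 2 := by
        set q := R⁻¹ * (R ^ 2 + x ^ 2) with hqd
        have hq0 : 0 < q := by positivity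
        have : R * (R ^ 2 + x ^ 2)⁻¹ = q⁻¹ := by rw [hqd, mul_inv, inv_inv]
        rw [this]
        have : q⁻¹ + q * y ^ 2 - y = q⁻¹ * ((q * y - 1/2) ^ 2 + 3/4) := by
          field_simp; ring
        have : 0 ≤ q⁻¹ * ((q * y - 1/2) ^ 2 + 3/4) := by positivity
        linarith
      linarith
    calc ∫ x, ‖𝓕 F x‖ ≤ ∫ x, (R⁻¹ * (1 + (x / R) ^ 2)⁻¹
        + (R * ‖𝓕 F x‖ ^ 2 + R⁻¹ * ‖𝓕 (deriv F) x‖ ^ 2)) :=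
          integral_mono i0 ((i3.const_mul _).add ((i1.const_mul _).add (i2.const_mul _))) hpt
      _ = R⁻¹ * (R * Real.pi) + (R * ∫ x, f x ^ 2) + R⁻¹ * ∫ x, deriv f x ^ 2 := by
          have hi : Integrable (fun x => R * ‖𝓕 F x‖ ^ 2 + R⁻¹ * ‖𝓕 (deriv F) x‖ ^ 2) :=
            (i1.const_mul _).add (i2.const_mul _)
          rw [integral_add (i3.const_mul _) hi,
            integral_add (i1.const_mul _) (i2.const_mul _), integral_const_mul, integral_const_mul,
            integral_const_mul, e1, e2, e3, add_assoc]
      _ ≤ R⁻¹ * (R * Real.pi) + (R * (A * Real.pi)) + R⁻¹ * (B * Real.pi) := by gcongr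
      _ = _ := by field_simp
  constructor
  · exact i0.comp_div (by positivity)
  · rw [Measure.integral_comp_div (fun x : ℝ => ‖𝓕 F x‖) (2 * Real.pi), smul_eq_mul,
      abs_of_pos (by positivity)]
    gcongr

theorem aux_integrable (f : ℝ → ℝ) (hf : ContDiff ℝ (⊤ : ℕ∞) f) (hc : HasCompactSupport f) :
    Integrable (fun ξ : ℝ =>
      ‖∫ l : ℝ, ((f l : ℝ) : ℂ) * Complex.exp (-(Complex.I * l * ξ))‖) := by
  have h1 : ∀ g : ℝ → ℝ, Continuous g → HasCompactSupport g →
      ∃ A : ℝ, ∀ x, g x ^ 2 ≤ A * (1 + x ^ 2)⁻¹ := by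
    intro g hg hgc
    have hc1 : Continuous (fun x => g x * (g x * (1 + x ^ 2))) := by fun_prop
    obtain ⟨A, hA⟩ := hc1.bounded_above_of_compact_support hgc.mul_right
    refine ⟨A, fun x => ?_⟩
    have h2 := (le_abs_self _).trans (hA x)
    rw [← div_eq_mul_inv, le_div_iff₀ (by positivity)]
    linarith
  obtain ⟨A, hA⟩ := h1 f hf.continuous hc
  obtain ⟨B, hB⟩ := h1 (deriv f) (hf.continuous_deriv (by simp)) hc.deriv
  exact (aux_L2 f hf hc A B 1 one_pos hA hB).1

theorem aux_scale (f : ℝ → ℝ) (r : ℝ) (hr : 0 < r) :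
    ∫ ξ : ℝ, ‖∫ l : ℝ, ((f (l / r) : ℝ) : ℂ) * Complex.exp (-(Complex.I * l * ξ))‖ =
    ∫ ξ : ℝ, ‖∫ l : ℝ, ((f l : ℝ) : ℂ) * Complex.exp (-(Complex.I * l * ξ))‖ := by
  have h1 : ∀ ξ : ℝ, ‖∫ l : ℝ, ((f (l / r) : ℝ) : ℂ) * Complex.exp (-(Complex.I * l * ξ))‖
      = r * ‖∫ l : ℝ, ((f l : ℝ) : ℂ) * Complex.exp (-(Complex.I * l * (r * ξ : ℝ)))‖ := by
    intro ξ
    have h2 := Measure.integral_comp_div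
      (fun l : ℝ => ((f l : ℝ) : ℂ) * Complex.exp (-(Complex.I * l * (r * ξ : ℝ)))) r
    have h3 : (fun l : ℝ => ((f (l / r) : ℝ) : ℂ) * Complex.exp (-(Complex.I * l * ξ)))
      = fun l : ℝ => ((f (l / r) : ℝ) : ℂ) *
        Complex.exp (-(Complex.I * (l / r : ℝ) * (r * ξ : ℝ))) := by
      funext l
      have : (r : ℂ) ≠ 0 := by exact_mod_cast hr.ne'
      congr 3
      push_cast
      field_simp
    rw [h3, h2, norm_smul, abs_of_pos hr, Real.norm_of_nonneg hr.le]
  simp_rw [h1]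
  rw [integral_const_mul, Measure.integral_comp_mul_left
    (fun ξ : ℝ => ‖∫ l : ℝ, ((f l : ℝ) : ℂ) * Complex.exp (-(Complex.I * l * ξ))‖) r,
    abs_of_pos (inv_pos.2 hr), smul_eq_mul, ← mul_assoc, mul_inv_cancel₀ hr.ne', one_mul]

theorem aux_bounds (lam0 : ℝ) (χ φ : ℝ → ℝ) (hχ : ContDiff ℝ (⊤ : ℕ∞) χ)
    (hχ0 : ∀ x : ℝ, x ≤ lam0 → χ x = 0) (hχ1 : ∀ x : ℝ, 2 * lam0 ≤ x → χ x = 1)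
    (hφ : ContDiff ℝ (⊤ : ℕ∞) φ) (hφ0 : ∀ x : ℝ, 2 ≤ |x| → φ x = 0) :
    ∃ K : ℝ, 1 ≤ K ∧ (∀ x, |φ x| ≤ K) ∧ (∀ x, |deriv φ x| ≤ K) ∧ (∀ x, |x * deriv φ x| ≤ K) ∧
      (∀ x, |deriv χ x| ≤ K) ∧ (∀ x, |x * deriv χ x| ≤ K) := by
  have hφc : HasCompactSupport φ := by
    refine HasCompactSupport.intro (isCompact_Icc (a := (-2 : ℝ)) (b := 2)) fun x hx => hφ0 x ?_
    by_contra h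
    exact hx (Set.mem_Icc.2 (abs_le.1 (not_le.1 h).le))
  have hχc : HasCompactSupport (deriv χ) := by
    refine HasCompactSupport.intro (isCompact_Icc (a := lam0) (b := 2 * lam0)) fun x hx => ?_
    rcases lt_or_ge x lam0 with h | h
    · have : χ =ᶠ[nhds x] fun _ => 0 := by
        filter_upwards [Iio_mem_nhds h] with y hy using hχ0 y (le_of_lt hy)
      rw [this.deriv_eq]; simp
    · have h2 : 2 * lam0 < x := by
        by_contra h'
        exact hx ⟨h, not_lt.1 h'⟩
      have : χ =ᶠ[nhds x] fun _ => 1 := by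
        filter_upwards [Ioi_mem_nhds h2] with y hy using hχ1 y (le_of_lt hy)
      rw [this.deriv_eq]; simp
  have cφ : Continuous (deriv φ) := hφ.continuous_deriv (by simp)
  have cχ : Continuous (deriv χ) := hχ.continuous_deriv (by simp)
  obtain ⟨a, ha⟩ := hφ.continuous.bounded_above_of_compact_support hφc
  obtain ⟨b, hb⟩ := cφ.bounded_above_of_compact_support hφc.deriv
  obtain ⟨c, hc⟩ := (continuous_id.mul cφ).bounded_above_of_compact_support hφc.deriv.mul_left
  obtain ⟨d, hd⟩ := cχ.bounded_above_of_compact_support hχc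
  obtain ⟨e, he⟩ := (continuous_id.mul cχ).bounded_above_of_compact_support hχc.mul_left
  have pa := (norm_nonneg _).trans (ha 0)
  have pb := (norm_nonneg _).trans (hb 0)
  have pc := (norm_nonneg _).trans (hc 0)
  have pd := (norm_nonneg _).trans (hd 0)
  have pe := (norm_nonneg _).trans (he 0)
  refine ⟨1 + a + b + c + d + e, by linarith, fun x => (ha x).trans (by linarith),
    fun x => (hb x).trans (by linarith), fun x => (hc x).trans (by linarith),
    fun x => (hd x).trans (by linarith), fun x => (he x).trans (by linarith)⟩

theorem aux_inv (lam0 l : ℝ) (hlam0 : 0 < lam0) (hl : lam0 ≤ l ^ 2) :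
    (l ^ 2)⁻¹ ≤ (1 + lam0⁻¹) * (1 + l ^ 2)⁻¹ := by
  have h : 0 < l ^ 2 := hlam0.trans_le hl
  rw [← div_eq_mul_inv, le_div_iff₀ (by positivity), mul_add, mul_one, inv_mul_cancel₀ h.ne']
  have := inv_anti₀ hlam0 hl
  linarith

theorem aux_pos (lam0 : ℝ) (hlam0 : 0 < lam0)
    (χ φ : ℝ → ℝ) (hχ : ContDiff ℝ (⊤ : ℕ∞) χ)
    (hχ0 : ∀ x : ℝ, x ≤ lam0 → χ x = 0)
    (hχr : ∀ x : ℝ, χ x ∈ Set.Icc (0 : ℝ) 1)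
    (hφ : ContDiff ℝ (⊤ : ℕ∞) φ)
    (hφ0 : ∀ x : ℝ, 2 ≤ |x| → φ x = 0) (K : ℝ) (hK : 1 ≤ K) (k1 : ∀ x, |φ x| ≤ K)
    (k3 : ∀ x, |x * deriv φ x| ≤ K) (k5 : ∀ x, |x * deriv χ x| ≤ K)
    (n : ℕ) (hn : 1 ≤ n) (L : ℝ) (hL : 1 ≤ L) :
    (∫ ξ : ℝ, ‖∫ l : ℝ, ((χ (l ^ 2) * φ (l ^ 2 / L) * l ^ (-(n : ℤ)) *
            lam0 ^ ((n : ℝ) / 2) : ℝ) : ℂ) * Complex.exp (-(Complex.I * l * ξ))‖)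
        ≤ 2 * Real.pi * (Real.pi * (1 + (1 + (n : ℝ)) * (K ^ 2 * lam0 * (1 + lam0⁻¹)) +
          (5 * K ^ 2 * (1 + n)) ^ 2 * (1 + lam0⁻¹) / (1 + n))) := by
  set c := lam0 ^ ((n : ℝ) / 2) with hc
  have hc2 : c ^ 2 = lam0 ^ n := by
    rw [hc, ← Real.rpow_natCast, ← Real.rpow_mul hlam0.le, ← Real.rpow_natCast]
    congr 1
    push_cast
    ring
  have hL0 : 0 < L := by linarith
  have hzero : ∀ l : ℝ, l ^ 2 < lam0 →
      (fun l : ℝ => χ (l ^ 2) * φ (l ^ 2 / L) * l ^ (-(n : ℤ)) * c) =ᶠ[nhds l] fun _ => 0 := by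
    intro l hl
    have : ∀ᶠ y : ℝ in nhds l, y ^ 2 < lam0 :=
      (continuous_pow 2).continuousAt.eventually_lt continuousAt_const hl
    filter_upwards [this] with y hy
    rw [hχ0 _ hy.le]; ring
  have hp : ∀ l : ℝ, lam0 ≤ l ^ 2 → (l ^ (-(n : ℤ)) * c) ^ 2 ≤ lam0 * (l ^ 2)⁻¹ ∧
      (l ^ (-(n : ℤ)) * c) ^ 2 ≤ 1 := by
    intro l hl
    have h : 0 < l ^ 2 := hlam0.trans_le hl
    have e : (l ^ (-(n : ℤ)) * c) ^ 2 = (lam0 * (l ^ 2)⁻¹) ^ n := by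
      rw [mul_pow, hc2, mul_pow, zpow_neg, zpow_natCast, inv_pow, inv_pow, ← pow_mul, ← pow_mul,
        mul_comm 2 n, mul_comm]
    have h1 : lam0 * (l ^ 2)⁻¹ ≤ 1 := by
      rw [← div_eq_mul_inv, div_le_one h]; exact hl
    rw [e]
    exact ⟨pow_le_of_le_one (by positivity) h1 (by omega), pow_le_one₀ (by positivity) h1⟩
  refine (aux_L2 (fun l : ℝ => χ (l ^ 2) * φ (l ^ 2 / L) * l ^ (-(n : ℤ)) * c)
    ?_ ?_ _ _ (1 + n) (by positivity) ?_ ?_).2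
  · rw [contDiff_iff_contDiffAt]
    intro l
    by_cases hl : l = 0
    · exact contDiffAt_const.congr_of_eventuallyEq (hzero l (by rw [hl]; simpa using hlam0))
    · have h1 : ContDiff ℝ (⊤ : ℕ∞) (fun l : ℝ => χ (l ^ 2) * φ (l ^ 2 / L)) := by fun_prop
      have h2 : ContDiffAt ℝ (⊤ : ℕ∞) (fun l : ℝ => l ^ (-(n : ℤ))) l := by
        simp only [zpow_neg, zpow_natCast]
        exact (contDiffAt_id.pow n).inv (pow_ne_zero _ hl)
      exact (h1.contDiffAt.mul h2).mul contDiffAt_const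
  · refine HasCompactSupport.intro (isCompact_Icc (a := -(2 * L)) (b := 2 * L)) fun x hx => ?_
    have h1 : 2 * L < |x| := by
      by_contra h
      exact hx (Set.mem_Icc.2 (abs_le.1 (not_lt.1 h)))
    have h2 : 2 ≤ |x ^ 2 / L| := by
      rw [abs_of_nonneg (by positivity), le_div_iff₀ hL0, ← sq_abs]
      nlinarith
    simp only [hφ0 _ h2]; ring
  · intro l
    rcases lt_or_ge (l ^ 2) lam0 with h | h
    · rw [hχ0 _ h.le]
      simp only [zero_mul, ne_eq, OfNat.ofNat_ne_zero, not_false_eq_true, zero_pow]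
      positivity
    · have e : (χ (l ^ 2) * φ (l ^ 2 / L) * l ^ (-(n : ℤ)) * c) ^ 2
        = (χ (l ^ 2) * φ (l ^ 2 / L)) ^ 2 * (l ^ (-(n : ℤ)) * c) ^ 2 := by ring
      have h1 : |χ (l ^ 2) * φ (l ^ 2 / L)| ≤ K := by
        rw [abs_mul, abs_of_nonneg (hχr _).1]
        nlinarith [(hχr (l ^ 2)).1, (hχr (l ^ 2)).2, k1 (l ^ 2 / L), abs_nonneg (φ (l ^ 2 / L))]
      have h2 : (χ (l ^ 2) * φ (l ^ 2 / L)) ^ 2 ≤ K ^ 2 := sq_le_sq' (abs_le.1 h1).1 (abs_le.1 h1).2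
      calc _ = _ := e
        _ ≤ K ^ 2 * (lam0 * (l ^ 2)⁻¹) := by
          exact mul_le_mul h2 (hp l h).1 (sq_nonneg _) (sq_nonneg _)
        _ ≤ K ^ 2 * (lam0 * ((1 + lam0⁻¹) * (1 + l ^ 2)⁻¹)) := by
          gcongr
          exact aux_inv lam0 l hlam0 h
        _ = _ := by ring
  · intro l
    rcases lt_or_ge (l ^ 2) lam0 with h | h
    · rw [(hzero l h).deriv_eq]
      simp only [deriv_const, ne_eq, OfNat.ofNat_ne_zero, not_false_eq_true, zero_pow]
      positivity
    · have hl2 : 0 < l ^ 2 := hlam0.trans_le h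
      have hl : l ≠ 0 := by rintro rfl; simp at hl2
      have d1 : HasDerivAt (fun l : ℝ => χ (l ^ 2)) (deriv χ (l ^ 2) * (2 * l)) l := by
        have := ((hχ.differentiable (by simp)).differentiableAt (x := l ^ 2)).hasDerivAt.comp l
          (hasDerivAt_pow 2 l)
        simpa [Function.comp_def] using this
      have d2 : HasDerivAt (fun l : ℝ => φ (l ^ 2 / L)) (deriv φ (l ^ 2 / L) * (2 * l / L)) l := by
        have := ((hφ.differentiable (by simp)).differentiableAt (x := l ^ 2 / L)).hasDerivAt.comp l
          ((hasDerivAt_pow 2 l).div_const L)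
        simpa [Function.comp_def] using this
      have d3 := hasDerivAt_zpow (-(n : ℤ)) l (Or.inl hl)
      have d := (((d1.mul d2).mul d3).mul_const c).deriv
      have e : deriv (fun l : ℝ => χ (l ^ 2) * φ (l ^ 2 / L) * l ^ (-(n : ℤ)) * c) l =
          l⁻¹ * (2 * ((l ^ 2 * deriv χ (l ^ 2)) * φ (l ^ 2 / L))
            + 2 * (χ (l ^ 2) * (l ^ 2 / L * deriv φ (l ^ 2 / L)))
            - n * (χ (l ^ 2) * φ (l ^ 2 / L))) * (l ^ (-(n : ℤ)) * c) := by
        refine Eq.trans d ?_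
        rw [zpow_sub_one₀ hl, Pi.mul_apply]
        push_cast
        field_simp
        ring
      rw [e]
      have m1 : |(l ^ 2 * deriv χ (l ^ 2)) * φ (l ^ 2 / L)| ≤ K * K := by
        rw [abs_mul]
        exact mul_le_mul (k5 _) (k1 _) (abs_nonneg _) (by linarith)
      have hχa : |χ (l ^ 2)| ≤ 1 := by
        rw [abs_of_nonneg (hχr _).1]; exact (hχr _).2
      have m2 : |χ (l ^ 2) * (l ^ 2 / L * deriv φ (l ^ 2 / L))| ≤ 1 * K := by
        rw [abs_mul]
        exact mul_le_mul hχa (k3 _) (abs_nonneg _) (by linarith)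
      have m3 : |χ (l ^ 2) * φ (l ^ 2 / L)| ≤ 1 * K := by
        rw [abs_mul]
        exact mul_le_mul hχa (k1 _) (abs_nonneg _) (by linarith)
      have hn0 : (0 : ℝ) ≤ n := Nat.cast_nonneg n
      have hKK : K ≤ K ^ 2 := by nlinarith
      set X := (l ^ 2 * deriv χ (l ^ 2)) * φ (l ^ 2 / L)
      set Y := χ (l ^ 2) * (l ^ 2 / L * deriv φ (l ^ 2 / L))
      set Z := χ (l ^ 2) * φ (l ^ 2 / L)
      have m4 : |2 * X + 2 * Y - n * Z| ≤ 5 * K ^ 2 * (1 + n) := by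
        have hz : |(n : ℝ) * Z| ≤ n * K ^ 2 := by
          rw [abs_mul, abs_of_nonneg hn0]
          exact mul_le_mul_of_nonneg_left (by linarith) hn0
        rw [abs_le] at m1 m2 hz ⊢
        have : 0 ≤ n * K ^ 2 := by positivity
        constructor <;> nlinarith
      have m5 : (2 * X + 2 * Y - n * Z) ^ 2 ≤ (5 * K ^ 2 * (1 + n)) ^ 2 :=
        sq_le_sq' (abs_le.1 m4).1 (abs_le.1 m4).2
      calc _ = (l ^ 2)⁻¹ * ((2 * X + 2 * Y - n * Z) ^ 2 * (l ^ (-(n : ℤ)) * c) ^ 2) := by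
            rw [mul_pow, mul_pow, inv_pow, mul_assoc]
        _ ≤ (l ^ 2)⁻¹ * ((5 * K ^ 2 * (1 + n)) ^ 2 * 1) := by
            gcongr
            exact (hp l h).2
        _ ≤ ((1 + lam0⁻¹) * (1 + l ^ 2)⁻¹) * ((5 * K ^ 2 * (1 + n)) ^ 2 * 1) := by
            gcongr
            exact aux_inv lam0 l hlam0 h
        _ = _ := by ring

theorem aux_h (lam0 : ℝ) (hlam0 : 0 < lam0)
    (χ φ : ℝ → ℝ) (hχ : ContDiff ℝ (⊤ : ℕ∞) χ)
    (hχ1 : ∀ x : ℝ, 2 * lam0 ≤ x → χ x = 1)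
    (hχr : ∀ x : ℝ, χ x ∈ Set.Icc (0 : ℝ) 1)
    (hφ : ContDiff ℝ (⊤ : ℕ∞) φ)
    (K : ℝ) (hK : 1 ≤ K) (k1 : ∀ x, |φ x| ≤ K)
    (k2 : ∀ x, |deriv φ x| ≤ K) (k4 : ∀ x, |deriv χ x| ≤ K)
    (L : ℝ) (hL : 1 ≤ L) :
    Integrable (fun ξ : ℝ => ‖∫ l : ℝ, (((1 - χ (l ^ 2)) * φ (l ^ 2 / L) : ℝ) : ℂ) *
      Complex.exp (-(Complex.I * l * ξ))‖) ∧
    (∫ ξ : ℝ, ‖∫ l : ℝ, (((1 - χ (l ^ 2)) * φ (l ^ 2 / L) : ℝ) : ℂ) *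
      Complex.exp (-(Complex.I * l * ξ))‖)
        ≤ 2 * Real.pi * (Real.pi * (1 + 1 * (K ^ 2 * (1 + 2 * lam0)) +
          (2 * lam0 * (4 * K ^ 2) ^ 2 * (1 + 2 * lam0)) / 1)) := by
  have hL0 : 0 < L := by linarith
  have hzero : ∀ l : ℝ, 2 * lam0 < l ^ 2 →
      (fun l : ℝ => (1 - χ (l ^ 2)) * φ (l ^ 2 / L)) =ᶠ[nhds l] fun _ => 0 := by
    intro l hl
    have : ∀ᶠ y : ℝ in nhds l, 2 * lam0 < y ^ 2 :=
      continuousAt_const.eventually_lt (continuous_pow 2).continuousAt hl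
    filter_upwards [this] with y hy
    rw [hχ1 _ hy.le]; ring
  have hinv : ∀ l : ℝ, l ^ 2 ≤ 2 * lam0 → 1 ≤ (1 + 2 * lam0) * (1 + l ^ 2)⁻¹ := by
    intro l hl
    rw [← div_eq_mul_inv, le_div_iff₀ (by positivity)]
    linarith
  have hχa : ∀ x, |1 - χ x| ≤ 1 := by
    intro x
    have := hχr x
    rw [abs_le]; constructor <;> linarith [this.1, this.2]
  refine aux_L2 (fun l : ℝ => (1 - χ (l ^ 2)) * φ (l ^ 2 / L)) ?_ ?_ _ _ 1 one_pos ?_ ?_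
  · fun_prop
  · refine HasCompactSupport.intro (isCompact_Icc (a := -(2 * lam0 + 1)) (b := 2 * lam0 + 1))
      fun x hx => ?_
    have h1 : 2 * lam0 + 1 < |x| := by
      by_contra h
      exact hx (Set.mem_Icc.2 (abs_le.1 (not_lt.1 h)))
    have h2 : 2 * lam0 ≤ x ^ 2 := by
      rw [← sq_abs]
      nlinarith
    simp only [hχ1 _ h2]; ring
  · intro l
    rcases lt_or_ge (2 * lam0) (l ^ 2) with h | h
    · simp only [hχ1 _ h.le, sub_self, zero_mul, ne_eq, OfNat.ofNat_ne_zero, not_false_eq_true,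
        zero_pow]
      positivity
    · have h1 : |(1 - χ (l ^ 2)) * φ (l ^ 2 / L)| ≤ 1 * K := by
        rw [abs_mul]
        exact mul_le_mul (hχa _) (k1 _) (abs_nonneg _) (by linarith)
      have h2 : ((1 - χ (l ^ 2)) * φ (l ^ 2 / L)) ^ 2 ≤ K ^ 2 := by
        rw [one_mul] at h1
        exact sq_le_sq' (abs_le.1 h1).1 (abs_le.1 h1).2
      calc _ ≤ K ^ 2 * 1 := by simpa using h2
        _ ≤ K ^ 2 * ((1 + 2 * lam0) * (1 + l ^ 2)⁻¹) := by gcongr; exact hinv l h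
        _ = _ := by ring
  · intro l
    rcases lt_or_ge (2 * lam0) (l ^ 2) with h | h
    · rw [(hzero l h).deriv_eq]
      simp only [deriv_const, ne_eq, OfNat.ofNat_ne_zero, not_false_eq_true, zero_pow]
      positivity
    · have d1 : HasDerivAt (fun l : ℝ => 1 - χ (l ^ 2)) (-(deriv χ (l ^ 2) * (2 * l))) l := by
        have := ((hχ.differentiable (by simp)).differentiableAt (x := l ^ 2)).hasDerivAt.comp l
          (hasDerivAt_pow 2 l)
        simpa [Function.comp_def] using this.const_sub 1
      have d2 : HasDerivAt (fun l : ℝ => φ (l ^ 2 / L)) (deriv φ (l ^ 2 / L) * (2 * l / L)) l := by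
        have := ((hφ.differentiable (by simp)).differentiableAt (x := l ^ 2 / L)).hasDerivAt.comp l
          ((hasDerivAt_pow 2 l).div_const L)
        simpa [Function.comp_def] using this
      have d := (d1.mul d2).deriv
      have e : deriv (fun l : ℝ => (1 - χ (l ^ 2)) * φ (l ^ 2 / L)) l =
          l * (2 * ((1 - χ (l ^ 2)) * (deriv φ (l ^ 2 / L) * L⁻¹))
            - 2 * (deriv χ (l ^ 2) * φ (l ^ 2 / L))) := by
        refine Eq.trans d ?_
        ring
      rw [e]
      have m1 : |deriv χ (l ^ 2) * φ (l ^ 2 / L)| ≤ K * K := by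
        rw [abs_mul]
        exact mul_le_mul (k4 _) (k1 _) (abs_nonneg _) (by linarith)
      have m2 : |(1 - χ (l ^ 2)) * (deriv φ (l ^ 2 / L) * L⁻¹)| ≤ 1 * (K * 1) := by
        rw [abs_mul, abs_mul]
        refine mul_le_mul (hχa _) (mul_le_mul (k2 _) ?_ (abs_nonneg _) (by linarith))
          (by positivity) zero_le_one
        rw [abs_of_pos (inv_pos.2 hL0)]
        exact inv_le_one_of_one_le₀ hL
      have hKK : K ≤ K ^ 2 := by nlinarith
      set X := deriv χ (l ^ 2) * φ (l ^ 2 / L)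
      set Y := (1 - χ (l ^ 2)) * (deriv φ (l ^ 2 / L) * L⁻¹)
      have m5 : (2 * Y - 2 * X) ^ 2 ≤ (4 * K ^ 2) ^ 2 := by
        rw [abs_le] at m1 m2
        apply sq_le_sq' <;> nlinarith
      calc _ = l ^ 2 * (2 * Y - 2 * X) ^ 2 * 1 := by ring
        _ ≤ (2 * lam0) * (4 * K ^ 2) ^ 2 * ((1 + 2 * lam0) * (1 + l ^ 2)⁻¹) := by
            gcongr
            exact hinv l h
        _ = _ := by ring

theorem stmt_0 (lam0 : ℝ) (hlam0 : 0 < lam0)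
    (χ φ : ℝ → ℝ) (hχ : ContDiff ℝ (⊤ : ℕ∞) χ)
    (hχ0 : ∀ x : ℝ, x ≤ lam0 → χ x = 0) (hχ1 : ∀ x : ℝ, 2 * lam0 ≤ x → χ x = 1)
    (hχr : ∀ x : ℝ, χ x ∈ Set.Icc (0 : ℝ) 1)
    (hφ : ContDiff ℝ (⊤ : ℕ∞) φ) (hφ1 : ∀ x : ℝ, |x| ≤ 1 → φ x = 1)
    (hφ0 : ∀ x : ℝ, 2 ≤ |x| → φ x = 0) :
    ∃ C : ℝ, ∀ (n : ℕ) (L : ℝ), 1 ≤ L →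
      (∫ ξ : ℝ, ‖∫ l : ℝ, ((χ (l ^ 2) * φ (l ^ 2 / L) * l ^ (-(n : ℤ)) *
            lam0 ^ ((n : ℝ) / 2) : ℝ) : ℂ) * Complex.exp (-(Complex.I * l * ξ))‖)
        ≤ C * (1 + n) := by
  obtain ⟨K, hK, k1, k2, k3, k4, k5⟩ := aux_bounds lam0 χ φ hχ hχ0 hχ1 hφ hφ0
  set C1 := 2 * Real.pi * (Real.pi * (1 + K ^ 2 * lam0 * (1 + lam0⁻¹) +
          (5 * K ^ 2) ^ 2 * (1 + lam0⁻¹))) with hC1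
  set C2 := 2 * Real.pi * (Real.pi * (1 + 1 * (K ^ 2 * (1 + 2 * lam0)) +
          (2 * lam0 * (4 * K ^ 2) ^ 2 * (1 + 2 * lam0)) / 1)) with hC2
  set C3 := ∫ ξ : ℝ, ‖∫ l : ℝ, ((φ (l ^ 2) : ℝ) : ℂ) * Complex.exp (-(Complex.I * l * ξ))‖
    with hC3
  have p1 : 0 ≤ C1 := by positivity
  have p2 : 0 ≤ C2 := by positivity
  have p3 : 0 ≤ C3 := integral_nonneg fun _ => norm_nonneg _
  refine ⟨C1 + C2 + C3, fun n L hL => ?_⟩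
  have hL0 : 0 < L := by linarith
  rcases Nat.eq_zero_or_pos n with rfl | hn
  · have hgs : ∀ M : ℝ, ContDiff ℝ (⊤ : ℕ∞) (fun l : ℝ => φ (l ^ 2 / M)) := by
      intro M; fun_prop
    have hgc : HasCompactSupport (fun l : ℝ => φ (l ^ 2 / L)) := by
      refine HasCompactSupport.intro (isCompact_Icc (a := -(2 * L)) (b := 2 * L)) fun x hx => ?_
      have h1 : 2 * L < |x| := by
        by_contra h
        exact hx (Set.mem_Icc.2 (abs_le.1 (not_lt.1 h)))
      have h2 : 2 ≤ |x ^ 2 / L| := by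
        rw [abs_of_nonneg (by positivity), le_div_iff₀ hL0, ← sq_abs]
        nlinarith
      exact hφ0 _ h2
    have hgi := aux_integrable _ (hgs L) hgc
    have hgv : ∫ ξ : ℝ, ‖∫ l : ℝ, ((φ (l ^ 2 / L) : ℝ) : ℂ) *
        Complex.exp (-(Complex.I * l * ξ))‖ = C3 := by
      rw [hC3, ← aux_scale (fun l => φ (l ^ 2)) (√L) (Real.sqrt_pos.2 hL0)]
      simp only [div_pow, Real.sq_sqrt hL0.le]
    obtain ⟨hhi, hhv⟩ := aux_h lam0 hlam0 χ φ hχ hχ1 hχr hφ K hK k1 k2 k4 L hL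
    have hcont : ∀ f : ℝ → ℝ, Continuous f → HasCompactSupport f → ∀ ξ : ℝ,
        Integrable (fun l : ℝ => ((f l : ℝ) : ℂ) * Complex.exp (-(Complex.I * l * ξ))) := by
      intro f hf hfc ξ
      refine Continuous.integrable_of_hasCompactSupport (by fun_prop) ?_
      exact HasCompactSupport.mul_right (hfc.comp_left (g := fun x : ℝ => (x : ℂ)) (by simp))
    have hpt : ∀ ξ : ℝ, ‖∫ l : ℝ, ((χ (l ^ 2) * φ (l ^ 2 / L) * l ^ (-((0 : ℕ) : ℤ)) *
            lam0 ^ (((0 : ℕ) : ℝ) / 2) : ℝ) : ℂ) * Complex.exp (-(Complex.I * l * ξ))‖ ≤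
        ‖∫ l : ℝ, ((φ (l ^ 2 / L) : ℝ) : ℂ) * Complex.exp (-(Complex.I * l * ξ))‖ +
        ‖∫ l : ℝ, (((1 - χ (l ^ 2)) * φ (l ^ 2 / L) : ℝ) : ℂ) *
          Complex.exp (-(Complex.I * l * ξ))‖ := by
      intro ξ
      refine le_trans (le_of_eq ?_) (norm_sub_le _ _)
      rw [← integral_sub (hcont (fun l => φ (l ^ 2 / L)) (hgs L).continuous hgc ξ)
        (hcont (fun l => (1 - χ (l ^ 2)) * φ (l ^ 2 / L)) ?_ hgc.mul_left ξ)]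
      · congr 2
        funext l
        simp
        ring
      · have := hχ.continuous
        have := hφ.continuous
        fun_prop
    calc _ ≤ _ := integral_mono_of_nonneg (Filter.Eventually.of_forall fun _ => norm_nonneg _)
            (hgi.add hhi) (Filter.Eventually.of_forall hpt)
      _ = _ := integral_add hgi hhi
      _ ≤ C3 + C2 := by rw [hgv]; gcongr
      _ ≤ _ := by simp; linarith
  · refine (aux_pos lam0 hlam0 χ φ hχ hχ0 hχr hφ hφ0 K hK k1 k3 k5 n hn L hL).trans ?_
    have hn0 : (0 : ℝ) ≤ n := Nat.cast_nonneg n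
    have h1 : (5 * K ^ 2 * (1 + (n : ℝ))) ^ 2 * (1 + lam0⁻¹) / (1 + n)
        = (1 + n) * ((5 * K ^ 2) ^ 2 * (1 + lam0⁻¹)) := by
      field_simp
    rw [h1]
    calc _ ≤ 2 * Real.pi * (Real.pi * ((1 + (n : ℝ)) * 1 +
            (1 + (n : ℝ)) * (K ^ 2 * lam0 * (1 + lam0⁻¹)) +
            (1 + n) * ((5 * K ^ 2) ^ 2 * (1 + lam0⁻¹)))) := by
          gcongr
          linarith
      _ = C1 * (1 + n) := by rw [hC1]; ring
      _ ≤ _ := by gcongr; linarith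
end

section
/- Let ψ : ℝ → ℝ be a smooth even function with ψ(λ) = 1 for −1 ≤ λ ≤ 1 and supp ψ ⊂ [−2, 2], let χ : ℝ → ℝ be a smooth even compactly supported function with χ = 1 on a neighborhood of 0, and let λ₀ > 0. Then there is a constant C, depending only on ψ, χ and λ₀, such that for all t ≥ 1, all a ∈ ℝ and all L ≥ 1, | ∫_0^∞ e^{itλ} sin(a√λ) ψ(√λ / L) (1 − χ(√λ / λ₀)) dλ | ≤ C t^{-3/2} |a|. -/
open MeasureTheory

lemma aux_ibp (F f : ℝ → ℂ) (w w' : ℝ → ℝ) (R M : ℝ) (hR : 0 ≤ R)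
    (hF : ∀ x, HasDerivAt F (f x) x) (hf : Continuous f)
    (hF0 : F 0 = 0)
    (hw : ∀ x, HasDerivAt w (w' x) x) (hw' : Continuous w')
    (hM : ∀ x, ‖F x‖ ≤ M) :
    ‖∫ x in (0:ℝ)..R, f x * (w x : ℂ)‖ ≤ M * (|w R| + ∫ x in (0:ℝ)..R, |w' x|) := by
  have hFc : Continuous F := continuous_iff_continuousAt.2 fun x => (hF x).continuousAt
  have h := intervalIntegral.integral_deriv_mul_eq_sub (a := 0) (b := R)
    (u := F) (v := fun x => (w x : ℂ)) (u' := f) (v' := fun x => (w' x : ℂ))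
    (fun x _ => hF x) (fun x _ => (hw x).ofReal_comp)
    (hf.intervalIntegrable _ _) ((Complex.continuous_ofReal.comp hw').intervalIntegrable _ _)
  have hwc : Continuous w := continuous_iff_continuousAt.2 fun x => (hw x).continuousAt
  rw [intervalIntegral.integral_add ((by fun_prop : Continuous _).intervalIntegrable _ _)
    ((by fun_prop : Continuous _).intervalIntegrable _ _)] at h
  have h2 : ‖∫ x in (0:ℝ)..R, F x * (w' x : ℂ)‖ ≤ ∫ x in (0:ℝ)..R, M * |w' x| := by
    apply intervalIntegral.norm_integral_le_of_norm_le hR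
    · refine Filter.Eventually.of_forall fun x _ => ?_
      rw [norm_mul, Complex.norm_real, Real.norm_eq_abs]
      exact mul_le_mul_of_nonneg_right (hM x) (abs_nonneg _)
    · exact (by fun_prop : Continuous _).intervalIntegrable _ _
  rw [intervalIntegral.integral_const_mul] at h2
  have h3 : ∫ x in (0:ℝ)..R, f x * (w x : ℂ) = F R * w R - ∫ x in (0:ℝ)..R, F x * (w' x : ℂ) := by
    rw [hF0] at h; linear_combination h
  rw [h3]
  refine (norm_sub_le _ _).trans ?_
  rw [norm_mul, Complex.norm_real, Real.norm_eq_abs]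
  have := mul_le_mul_of_nonneg_right (hM R) (abs_nonneg (w R))
  linarith

lemma aux_fresnel1 (d : ℝ) (hd : 0 ≤ d) :
    ‖∫ z in (0:ℝ)..d, Complex.exp (Complex.I * ((z ^ 2 : ℝ) : ℂ))‖ ≤ 2 := by
  have hn : ∀ r : ℝ, ‖Complex.exp (Complex.I * (r : ℂ))‖ = 1 := fun r => by
    rw [mul_comm]; exact Complex.norm_exp_ofReal_mul_I r
  have hb : ∀ a b : ℝ, ‖∫ z in a..b, Complex.exp (Complex.I * ((z ^ 2 : ℝ) : ℂ))‖ ≤ |b - a| := by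
    intro a b
    have := intervalIntegral.norm_integral_le_of_norm_le_const (a := a) (b := b) (C := 1)
      (f := fun z : ℝ => Complex.exp (Complex.I * ((z ^ 2 : ℝ) : ℂ))) (fun x _ => (hn _).le)
    simpa using this
  have hc : Continuous fun z : ℝ => Complex.exp (Complex.I * ((z ^ 2 : ℝ) : ℂ)) := by fun_prop
  rcases le_total d 1 with h1 | h1
  · refine (hb 0 d).trans ?_
    rw [sub_zero, abs_of_nonneg hd]; linarith
  rw [← intervalIntegral.integral_add_adjacent_intervals (hc.intervalIntegrable 0 1)
    (hc.intervalIntegrable 1 d)]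
  have hA : ‖∫ z in (0:ℝ)..1, Complex.exp (Complex.I * ((z ^ 2 : ℝ) : ℂ))‖ ≤ 1 := by
    simpa using hb 0 1
  have hpos : ∀ x ∈ Set.uIcc 1 d, 0 < x := fun x hx => by
    rw [Set.uIcc_of_le h1] at hx; linarith [hx.1]
  -- integrate by parts on [1,d]
  have hderE : ∀ x : ℝ, HasDerivAt (fun z : ℝ => Complex.exp (Complex.I * ((z ^ 2 : ℝ) : ℂ)))
      (Complex.exp (Complex.I * ((x ^ 2 : ℝ) : ℂ)) * (Complex.I * ((2 * x : ℝ) : ℂ))) x := by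
    intro x
    have h := (hasDerivAt_pow 2 x).ofReal_comp
    have := (h.const_mul Complex.I).cexp
    simpa using this
  have hderV : ∀ x ∈ Set.uIcc 1 d, HasDerivAt (fun z : ℝ => (((z⁻¹ : ℝ)) : ℂ))
      ((-(x ^ 2)⁻¹ : ℝ) : ℂ) x := fun x hx =>
    (hasDerivAt_inv (hpos x hx).ne').ofReal_comp
  have hcV : ContinuousOn (fun x : ℝ => (-(x ^ 2)⁻¹ : ℝ)) (Set.uIcc 1 d) :=
    (ContinuousOn.inv₀ (by fun_prop) fun x hx => (pow_pos (hpos x hx) 2).ne').neg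
  have h := intervalIntegral.integral_mul_deriv_eq_deriv_mul (a := 1) (b := d)
    (v := fun z : ℝ => Complex.exp (Complex.I * ((z ^ 2 : ℝ) : ℂ)))
    (u := fun z : ℝ => (((z⁻¹ : ℝ)) : ℂ)) hderV (fun x _ => hderE x)
    ((Complex.continuous_ofReal.comp_continuousOn hcV).intervalIntegrable)
    ((by fun_prop : Continuous _).intervalIntegrable _ _)
  have hl : (∫ x in (1:ℝ)..d, (((x⁻¹ : ℝ)) : ℂ) *
      (Complex.exp (Complex.I * ((x ^ 2 : ℝ) : ℂ)) * (Complex.I * ((2 * x : ℝ) : ℂ))))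
      = 2 * Complex.I * ∫ x in (1:ℝ)..d, Complex.exp (Complex.I * ((x ^ 2 : ℝ) : ℂ)) := by
    rw [← intervalIntegral.integral_const_mul]
    apply intervalIntegral.integral_congr
    intro x hx
    have : (x : ℂ) ≠ 0 := by exact_mod_cast (hpos x hx).ne'
    simp only [Complex.ofReal_inv, Complex.ofReal_mul]
    field_simp
    push_cast
    ring
  rw [hl] at h
  have hr : ‖∫ x in (1:ℝ)..d, ((-(x ^ 2)⁻¹ : ℝ) : ℂ) *
      Complex.exp (Complex.I * ((x ^ 2 : ℝ) : ℂ))‖ ≤ ∫ x in (1:ℝ)..d, -(-(x ^ 2)⁻¹) := by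
    apply intervalIntegral.norm_integral_le_of_norm_le h1
    · refine Filter.Eventually.of_forall fun x _ => ?_
      rw [norm_mul, hn, Complex.norm_real, Real.norm_eq_abs, mul_one, abs_neg, neg_neg,
        abs_of_nonneg (by positivity)]
    · exact hcV.neg.intervalIntegrable
  have hi : ∫ x in (1:ℝ)..d, -(-(x ^ 2)⁻¹) = 1 - d⁻¹ := by
    rw [intervalIntegral.integral_neg, intervalIntegral.integral_eq_sub_of_hasDerivAt
      (f := fun x => x⁻¹) (fun x hx => hasDerivAt_inv (hpos x hx).ne') hcV.intervalIntegrable]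
    simp
  rw [hi] at hr
  have hfin : ‖2 * Complex.I * ∫ x in (1:ℝ)..d, Complex.exp (Complex.I * ((x ^ 2 : ℝ) : ℂ))‖ ≤
      d⁻¹ + 1 + (1 - d⁻¹) := by
    rw [h]
    refine (norm_sub_le _ _).trans (add_le_add ((norm_sub_le _ _).trans ?_) hr)
    rw [norm_mul, norm_mul, hn, hn, Complex.norm_real, Complex.norm_real, Real.norm_eq_abs,
      abs_of_nonneg (inv_nonneg.2 hd)]
    simp
  rw [norm_mul, norm_mul] at hfin
  simp only [Complex.norm_ofNat, Complex.norm_I] at hfin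
  refine (norm_add_le _ _).trans ?_
  linarith

lemma aux_fresnel2 (d : ℝ) :
    ‖∫ z in (0:ℝ)..d, Complex.exp (Complex.I * ((z ^ 2 : ℝ) : ℂ))‖ ≤ 2 := by
  rcases le_total 0 d with h | h
  · exact aux_fresnel1 d h
  · have := intervalIntegral.integral_comp_neg (a := 0) (b := -d)
      (fun z : ℝ => Complex.exp (Complex.I * ((z ^ 2 : ℝ) : ℂ)))
    simp only [neg_neg, neg_zero, neg_sq] at this
    rw [intervalIntegral.integral_symm, ← this, norm_neg]
    exact aux_fresnel1 (-d) (by linarith)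

lemma aux_fresnel3 (c d : ℝ) :
    ‖∫ z in c..d, Complex.exp (Complex.I * ((z ^ 2 : ℝ) : ℂ))‖ ≤ 4 := by
  have hc : Continuous fun z : ℝ => Complex.exp (Complex.I * ((z ^ 2 : ℝ) : ℂ)) := by fun_prop
  rw [← intervalIntegral.integral_interval_sub_left (hc.intervalIntegrable 0 d)
    (hc.intervalIntegrable 0 c)]
  refine (norm_sub_le _ _).trans ?_
  linarith [aux_fresnel2 c, aux_fresnel2 d]

lemma aux_vdc (t b x : ℝ) (ht : 0 < t) :
    ‖∫ y in (0:ℝ)..x, Complex.exp (Complex.I * ((t * y ^ 2 + b * y : ℝ) : ℂ))‖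
      ≤ 4 / Real.sqrt t := by
  have hs : 0 < Real.sqrt t := Real.sqrt_pos.2 ht
  have hs2 : Real.sqrt t ^ 2 = t := Real.sq_sqrt ht.le
  have h := intervalIntegral.integral_comp_mul_add (a := 0) (b := x)
    (fun z : ℝ => Complex.exp (Complex.I * ((z ^ 2 : ℝ) : ℂ))) hs.ne' (b / (2 * Real.sqrt t))
  have e : ∀ y : ℝ, Complex.exp (Complex.I * ((t * y ^ 2 + b * y : ℝ) : ℂ)) =
      Complex.exp (Complex.I * ((-((b / (2 * Real.sqrt t)) ^ 2) : ℝ) : ℂ)) *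
      Complex.exp (Complex.I * (((Real.sqrt t * y + b / (2 * Real.sqrt t)) ^ 2 : ℝ) : ℂ)) := by
    intro y
    rw [← Complex.exp_add, ← mul_add, ← Complex.ofReal_add]
    congr 3
    have : Real.sqrt t * (b / (2 * Real.sqrt t)) = b / 2 := by field_simp
    linear_combination -y^2 * hs2 - 2 * y * this
  simp_rw [e]
  rw [intervalIntegral.integral_const_mul, h, norm_mul, mul_comm Complex.I,
    Complex.norm_exp_ofReal_mul_I, one_mul, norm_smul, norm_inv, Real.norm_eq_abs, abs_of_pos hs,
    div_eq_inv_mul 4]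
  exact mul_le_mul_of_nonneg_left (aux_fresnel3 _ _) (inv_nonneg.2 hs.le)

lemma aux_cos (t b x : ℝ) (ht : 0 < t) :
    ‖∫ y in (0:ℝ)..x, Complex.exp (Complex.I * ((t * y ^ 2 : ℝ) : ℂ)) * (Real.cos (b * y) : ℂ)‖
      ≤ 4 / Real.sqrt t := by
  have e : ∀ y : ℝ, Complex.exp (Complex.I * ((t * y ^ 2 : ℝ) : ℂ)) * (Real.cos (b * y) : ℂ) =
      (1/2 : ℂ) * (Complex.exp (Complex.I * ((t * y ^ 2 + b * y : ℝ) : ℂ)) +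
      Complex.exp (Complex.I * ((t * y ^ 2 + (-b) * y : ℝ) : ℂ))) := by
    intro y
    rw [Complex.ofReal_cos, Complex.cos, Complex.ofReal_add, Complex.ofReal_add, mul_add Complex.I,
      mul_add Complex.I, Complex.exp_add, Complex.exp_add]
    push_cast
    rw [show (b * y : ℂ) * Complex.I = Complex.I * (b * y) by ring,
      show -(b * y : ℂ) * Complex.I = Complex.I * (-b * y) by ring]
    ring
  simp_rw [e]
  rw [intervalIntegral.integral_const_mul, intervalIntegral.integral_add
    ((by fun_prop : Continuous _).intervalIntegrable _ _)
    ((by fun_prop : Continuous _).intervalIntegrable _ _), norm_mul]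
  have h1 := aux_vdc t b x ht
  have h2 := aux_vdc t (-b) x ht
  have h3 := norm_add_le
    (∫ y in (0:ℝ)..x, Complex.exp (Complex.I * ((t * y ^ 2 + b * y : ℝ) : ℂ)))
    (∫ y in (0:ℝ)..x, Complex.exp (Complex.I * ((t * y ^ 2 + (-b) * y : ℝ) : ℂ)))
  have : ‖(1/2 : ℂ)‖ = 1/2 := by norm_num
  rw [this]
  linarith

lemma aux_dil (f : ℝ → ℝ) (hf : Continuous f) (hc : HasCompactSupport f) (L R : ℝ) (hL : 0 < L)
    (hR : 0 ≤ R) : ∫ x in (0:ℝ)..R, |f (x / L) / L| ≤ ∫ x, |f x| := by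
  have e : ∀ x, |f (x / L) / L| = L⁻¹ * |f (x / L)| := fun x => by
    rw [abs_div, abs_of_pos hL]; field_simp
  simp_rw [e]
  rw [intervalIntegral.integral_const_mul,
    intervalIntegral.integral_comp_div (fun x => |f x|) hL.ne', smul_eq_mul,
    inv_mul_cancel_left₀ hL.ne', zero_div,
    intervalIntegral.integral_of_le (div_nonneg hR hL.le)]
  exact setIntegral_le_integral (hf.integrable_of_hasCompactSupport hc).abs
    (Filter.Eventually.of_forall fun x => abs_nonneg _)

lemma aux_amp (u v : ℝ → ℝ) (hu : ContDiff ℝ 1 u) (hv : ContDiff ℝ 1 v)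
    (hu' : HasCompactSupport (deriv u)) (hv' : HasCompactSupport (deriv v))
    (A B : ℝ) (hA : ∀ x, |u x| ≤ A) (hB : ∀ x, |v x| ≤ B) :
    ∃ C : ℝ, ∀ t b L l R : ℝ, 0 < t → 0 < L → 0 < l → 0 ≤ R →
      ‖∫ x in (0:ℝ)..R, (Complex.exp (Complex.I * ((t * x ^ 2 : ℝ) : ℂ)) * (Real.cos (b * x) : ℂ)) *
        ((u (x / L) * v (x / l) : ℝ) : ℂ)‖ ≤ C / Real.sqrt t := by
  have hA0 : 0 ≤ A := (abs_nonneg _).trans (hA 0)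
  have hB0 : 0 ≤ B := (abs_nonneg _).trans (hB 0)
  have cu' : Continuous (deriv u) := hu.continuous_deriv le_rfl
  have cv' : Continuous (deriv v) := hv.continuous_deriv le_rfl
  have cu := hu.continuous
  have cv := hv.continuous
  refine ⟨4 * (A * B + ((∫ x, |deriv u x|) * B + A * ∫ x, |deriv v x|)), ?_⟩
  intro t b L l R ht hL hl hR
  have hcE : Continuous fun x : ℝ =>
    (Complex.exp (Complex.I * ((t * x ^ 2 : ℝ) : ℂ)) * (Real.cos (b * x) : ℂ)) := by fun_prop
  have hd : ∀ (f : ℝ → ℝ), ContDiff ℝ 1 f → ∀ m x : ℝ,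
      HasDerivAt (fun x => f (x / m)) (deriv f (x / m) / m) x := by
    intro f hf m x
    have h1 : HasDerivAt f (deriv f (x / m)) (x / m) :=
      (hf.differentiable one_ne_zero _).hasDerivAt
    have := h1.comp x ((hasDerivAt_id x).div_const m)
    rw [mul_one_div] at this
    exact this
  have h := aux_ibp (fun x => ∫ y in (0:ℝ)..x,
      Complex.exp (Complex.I * ((t * y ^ 2 : ℝ) : ℂ)) * (Real.cos (b * y) : ℂ))
    (fun x => Complex.exp (Complex.I * ((t * x ^ 2 : ℝ) : ℂ)) * (Real.cos (b * x) : ℂ))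
    (fun x => u (x / L) * v (x / l))
    (fun x => deriv u (x / L) / L * v (x / l) + u (x / L) * (deriv v (x / l) / l)) R
    (4 / Real.sqrt t) hR
    (fun x => hcE.integral_hasStrictDerivAt 0 x |>.hasDerivAt) hcE (by simp)
    (fun x => (hd u hu L x).mul (hd v hv l x)) (by fun_prop)
    (fun x => aux_cos t b x ht)
  refine h.trans ?_
  have k1 : |u (R / L) * v (R / l)| ≤ A * B := by
    rw [abs_mul]; exact mul_le_mul (hA _) (hB _) (abs_nonneg _) hA0
  have k2 : (∫ x in (0:ℝ)..R, |deriv u (x / L) / L * v (x / l) + u (x / L) * (deriv v (x / l) / l)|)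
      ≤ ∫ x in (0:ℝ)..R, (|deriv u (x / L) / L| * B + A * |deriv v (x / l) / l|) := by
    apply intervalIntegral.integral_mono_on hR
      ((by fun_prop : Continuous _).intervalIntegrable _ _)
      ((by fun_prop : Continuous _).intervalIntegrable _ _)
    intro x _
    refine (abs_add_le _ _).trans ?_
    rw [abs_mul, abs_mul (u _)]
    exact add_le_add (mul_le_mul_of_nonneg_left (hB _) (abs_nonneg _))
      (mul_le_mul_of_nonneg_right (hA _) (abs_nonneg _))
  rw [intervalIntegral.integral_add ((by fun_prop : Continuous _).intervalIntegrable _ _)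
      ((by fun_prop : Continuous _).intervalIntegrable _ _), intervalIntegral.integral_mul_const,
      intervalIntegral.integral_const_mul] at k2
  have k3 := mul_le_mul_of_nonneg_right (aux_dil _ cu' hu' L R hL hR) hB0
  have k4 := mul_le_mul_of_nonneg_left (aux_dil _ cv' hv' l R hl hR) hA0
  rw [mul_div_right_comm]
  apply mul_le_mul_of_nonneg_left _ (by positivity)
  linarith

lemma aux_sin (E : ℝ → ℂ) (hE : Continuous E) (h : ℝ → ℝ) (hh : Continuous h) (R M a : ℝ)
    (hM : ∀ b, ‖∫ x in (0:ℝ)..R, (E x * (Real.cos (b * x) : ℂ)) * ((x * h x : ℝ) : ℂ)‖ ≤ M) :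
    ‖∫ x in (0:ℝ)..R, (E x * (Real.sin (a * x) : ℂ)) * (h x : ℂ)‖ ≤ M * |a| := by
  have e : ∀ x : ℝ, (E x * (Real.sin (a * x) : ℂ)) * (h x : ℂ) =
      a * ∫ s in (0:ℝ)..1, (E x * (Real.cos ((a * s) * x) : ℂ)) * ((x * h x : ℝ) : ℂ) := by
    intro x
    have k : ∫ s in (0:ℝ)..1, (a * x) * Real.cos ((a * s) * x) = Real.sin (a * x) := by
      rw [intervalIntegral.integral_eq_sub_of_hasDerivAt (f := fun s => Real.sin ((a * s) * x))]
      · simp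
      · intro s _
        have := (((hasDerivAt_id s).const_mul a).mul_const x).sin
        simpa [mul_comm] using this
      · exact (by fun_prop : Continuous _).intervalIntegrable _ _
    rw [intervalIntegral.integral_mul_const, intervalIntegral.integral_const_mul,
      intervalIntegral.integral_ofReal, ← k, intervalIntegral.integral_const_mul]
    push_cast
    ring
  simp_rw [e]
  rw [intervalIntegral.integral_const_mul, intervalIntegral_intervalIntegral_swap, norm_mul,
    Complex.norm_real, Real.norm_eq_abs, mul_comm]
  · apply mul_le_mul_of_nonneg_right _ (abs_nonneg a)
    have := intervalIntegral.norm_integral_le_of_norm_le_const (a := 0) (b := 1) (C := M)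
      (f := fun s : ℝ => ∫ x in (0:ℝ)..R, (E x * (Real.cos ((a * s) * x) : ℂ)) *
        ((x * h x : ℝ) : ℂ)) (fun s _ => hM (a * s))
    simpa using this
  · have hc : Continuous (Function.uncurry fun x s : ℝ =>
        (E x * (Real.cos ((a * s) * x) : ℂ)) * ((x * h x : ℝ) : ℂ)) := by
      unfold Function.uncurry
      fun_prop
    exact (hc.continuousOn.integrableOn_compact
      (isCompact_uIcc.prod isCompact_uIcc)).mono_set
      (Set.prod_mono Set.uIoc_subset_uIcc Set.uIoc_subset_uIcc)

lemma aux_dilder (f : ℝ → ℝ) (hf : ContDiff ℝ 1 f) (m x : ℝ) :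
    HasDerivAt (fun x => f (x / m)) (deriv f (x / m) / m) x := by
  have h1 : HasDerivAt f (deriv f (x / m)) (x / m) :=
    (hf.differentiable one_ne_zero _).hasDerivAt
  have := h1.comp x ((hasDerivAt_id x).div_const m)
  rw [mul_one_div] at this
  exact this

lemma aux_bdd (f : ℝ → ℝ) (hf : Continuous f) (hc : HasCompactSupport f) :
    ∃ A, ∀ x, |f x| ≤ A := by
  obtain ⟨A, hA⟩ := hf.bounded_above_of_compact_support hc
  exact ⟨A, hA⟩

/-- The substitution and first integration by parts. -/
lemma aux_main (t a R M N : ℝ) (ht : 0 < t) (hR : 0 ≤ R) (g h : ℝ → ℝ)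
    (hg : ∀ x, HasDerivAt g (h x) x) (hh : Continuous h) (hgR : ∀ x, R ≤ x → g x = 0)
    (hM : ∀ b, ‖∫ x in (0:ℝ)..R, (Complex.exp (Complex.I * ((t * x ^ 2 : ℝ) : ℂ)) *
      (Real.cos (b * x) : ℂ)) * ((g x : ℝ) : ℂ)‖ ≤ M)
    (hN : ∀ b, ‖∫ x in (0:ℝ)..R, (Complex.exp (Complex.I * ((t * x ^ 2 : ℝ) : ℂ)) *
      (Real.cos (b * x) : ℂ)) * ((x * h x : ℝ) : ℂ)‖ ≤ N) :
    ‖∫ l in Set.Ioi (0 : ℝ), Complex.exp (Complex.I * ((t * l : ℝ) : ℂ)) *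
          ((Real.sin (a * Real.sqrt l) * g (Real.sqrt l) : ℝ) : ℂ)‖ ≤ (M + N) / t * |a| := by
  have hgc : Continuous g := continuous_iff_continuousAt.2 fun x => (hg x).continuousAt
  have hsub : ∫ l in Set.Ioi (0 : ℝ), Complex.exp (Complex.I * ((t * l : ℝ) : ℂ)) *
          ((Real.sin (a * Real.sqrt l) * g (Real.sqrt l) : ℝ) : ℂ)
      = ∫ x in (0:ℝ)..R, ((Real.sin (a * x) * g x : ℝ) : ℂ) *
        (Complex.exp (Complex.I * ((t * x ^ 2 : ℝ) : ℂ)) * ((2 * x : ℝ) : ℂ)) := by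
    rw [← integral_comp_rpow_Ioi_of_pos (p := 2) (by norm_num),
      intervalIntegral.integral_of_le hR]
    have e : ∀ x ∈ Set.Ioi (0:ℝ), ((2 : ℝ) * x ^ ((2:ℝ) - 1)) •
        (Complex.exp (Complex.I * ((t * x ^ (2:ℝ) : ℝ) : ℂ)) *
          ((Real.sin (a * Real.sqrt (x ^ (2:ℝ))) * g (Real.sqrt (x ^ (2:ℝ))) : ℝ) : ℂ))
        = ((Real.sin (a * x) * g x : ℝ) : ℂ) *
        (Complex.exp (Complex.I * ((t * x ^ 2 : ℝ) : ℂ)) * ((2 * x : ℝ) : ℂ)) := by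
      intro x hx
      have hx0 : 0 ≤ x := le_of_lt hx
      rw [show (2:ℝ) - 1 = 1 by norm_num, Real.rpow_one, Real.rpow_two, Real.sqrt_sq hx0,
        Complex.real_smul]
      ring
    rw [setIntegral_congr_fun measurableSet_Ioi e]
    apply setIntegral_eq_of_subset_of_forall_sdiff_eq_zero measurableSet_Ioi
      Set.Ioc_subset_Ioi_self
    intro x hx
    have : R ≤ x := by
      by_contra hlt
      exact hx.2 ⟨hx.1, (not_le.1 hlt).le⟩
    simp [hgR x this]
  rw [hsub]
  have hE : ∀ x : ℝ, HasDerivAt (fun z : ℝ => Complex.exp (Complex.I * ((t * z ^ 2 : ℝ) : ℂ)))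
      (Complex.exp (Complex.I * ((t * x ^ 2 : ℝ) : ℂ)) *
        (Complex.I * ((t * (2 * x) : ℝ) : ℂ))) x := by
    intro x
    have h := ((hasDerivAt_pow 2 x).const_mul t).ofReal_comp
    have := (h.const_mul Complex.I).cexp
    simpa using this
  have hu : ∀ x : ℝ, HasDerivAt (fun x : ℝ => ((Real.sin (a * x) * g x : ℝ) : ℂ))
      ((a * Real.cos (a * x) * g x + Real.sin (a * x) * h x : ℝ) : ℂ) x := by
    intro x
    have h1 : HasDerivAt (fun x => Real.sin (a * x)) (a * Real.cos (a * x)) x := by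
      have := ((hasDerivAt_id x).const_mul a).sin
      simpa [mul_comm] using this
    exact (h1.mul (hg x)).ofReal_comp
  have hp := intervalIntegral.integral_mul_deriv_eq_deriv_mul (a := 0) (b := R)
    (fun x _ => hu x) (fun x _ => hE x)
    ((by fun_prop : Continuous _).intervalIntegrable _ _)
    ((by fun_prop : Continuous _).intervalIntegrable _ _)
  have e1 : (∫ x in (0:ℝ)..R, ((Real.sin (a * x) * g x : ℝ) : ℂ) *
        (Complex.exp (Complex.I * ((t * x ^ 2 : ℝ) : ℂ)) * (Complex.I * ((t * (2 * x) : ℝ) : ℂ))))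
      = (Complex.I * t) * ∫ x in (0:ℝ)..R, ((Real.sin (a * x) * g x : ℝ) : ℂ) *
        (Complex.exp (Complex.I * ((t * x ^ 2 : ℝ) : ℂ)) * ((2 * x : ℝ) : ℂ)) := by
    rw [← intervalIntegral.integral_const_mul]
    congr 1
    ext x
    push_cast
    ring
  have e2 : (∫ x in (0:ℝ)..R, ((a * Real.cos (a * x) * g x + Real.sin (a * x) * h x : ℝ) : ℂ) *
        Complex.exp (Complex.I * ((t * x ^ 2 : ℝ) : ℂ)))
      = a * (∫ x in (0:ℝ)..R, (Complex.exp (Complex.I * ((t * x ^ 2 : ℝ) : ℂ)) *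
      (Real.cos (a * x) : ℂ)) * ((g x : ℝ) : ℂ)) +
      ∫ x in (0:ℝ)..R, (Complex.exp (Complex.I * ((t * x ^ 2 : ℝ) : ℂ)) *
      (Real.sin (a * x) : ℂ)) * ((h x : ℝ) : ℂ) := by
    rw [← intervalIntegral.integral_const_mul, ← intervalIntegral.integral_add
      ((by fun_prop : Continuous _).intervalIntegrable _ _)
      ((by fun_prop : Continuous _).intervalIntegrable _ _)]
    congr 1
    ext x
    push_cast
    ring
  rw [e1, e2, hgR R le_rfl] at hp
  simp only [mul_zero, Real.sin_zero, zero_mul, Complex.ofReal_zero, sub_zero, zero_sub] at hp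
  have hs := aux_sin (fun x : ℝ => Complex.exp (Complex.I * ((t * x ^ 2 : ℝ) : ℂ)))
    (by fun_prop) h hh R N a hN
  have hn := congrArg norm hp
  rw [norm_neg, norm_mul, norm_mul, Complex.norm_I, Complex.norm_real, Real.norm_eq_abs,
    abs_of_pos ht, one_mul] at hn
  rw [div_mul_eq_mul_div, le_div_iff₀ ht, mul_comm, hn]
  refine (norm_add_le _ _).trans ?_
  rw [norm_mul, Complex.norm_real, Real.norm_eq_abs]
  have := mul_le_mul_of_nonneg_left (hM a) (abs_nonneg a)
  linarith

open MeasureTheory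

theorem stmt_4 (ψ χ : ℝ → ℝ) (lam0 : ℝ) (hlam0 : 0 < lam0)
    (hψ : ContDiff ℝ (⊤ : ℕ∞) ψ) (hψe : ∀ x : ℝ, ψ (-x) = ψ x)
    (hψ1 : ∀ x ∈ Set.Icc (-1 : ℝ) 1, ψ x = 1)
    (hψs : Function.support ψ ⊆ Set.Icc (-2 : ℝ) 2)
    (hχ : ContDiff ℝ (⊤ : ℕ∞) χ) (hχe : ∀ x : ℝ, χ (-x) = χ x)
    (hχc : HasCompactSupport χ)
    (hχ1 : ∃ δ > (0 : ℝ), ∀ x : ℝ, |x| ≤ δ → χ x = 1) :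
    ∃ C : ℝ, ∀ (t a L : ℝ), 1 ≤ t → 1 ≤ L →
      ‖∫ l in Set.Ioi (0 : ℝ), Complex.exp (Complex.I * ((t * l : ℝ) : ℂ)) *
          ((Real.sin (a * Real.sqrt l) * ψ (Real.sqrt l / L) *
            (1 - χ (Real.sqrt l / lam0)) : ℝ) : ℂ)‖
        ≤ C * t ^ (-(3 : ℝ) / 2) * |a| := by
  obtain ⟨C, hC⟩ : ∃ C : ℝ, ∀ (t a L : ℝ), 1 ≤ t → 1 ≤ L → ‖∫ l in Set.Ioi (0 : ℝ),
      Complex.exp (Complex.I * ((t * l : ℝ) : ℂ)) * ((Real.sin (a * Real.sqrt l) *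
        (ψ (Real.sqrt l / L) * (1 - χ (Real.sqrt l / lam0))) : ℝ) : ℂ)‖
        ≤ C / Real.sqrt t / t * |a| := by
    have hψc : HasCompactSupport ψ := HasCompactSupport.of_support_subset_isCompact
      isCompact_Icc hψs
    have hψ1' : ContDiff ℝ 1 ψ := hψ.of_le (by exact_mod_cast le_top)
    have hχ1' : ContDiff ℝ 1 χ := hχ.of_le (by exact_mod_cast le_top)
    have hdψ : ContDiff ℝ 1 (deriv ψ) := by
      have : ContDiff ℝ (1 + 1) ψ := by
        rw [one_add_one_eq_two]
        exact_mod_cast contDiff_infty.1 hψ 2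
      exact (contDiff_succ_iff_deriv.1 this).2.2
    have hdχ : ContDiff ℝ 1 (deriv χ) := by
      have : ContDiff ℝ (1 + 1) χ := by
        rw [one_add_one_eq_two]
        exact_mod_cast contDiff_infty.1 hχ 2
      exact (contDiff_succ_iff_deriv.1 this).2.2
    have hP : ContDiff ℝ 1 (fun y => y * deriv ψ y) := contDiff_id.mul hdψ
    have hQ : ContDiff ℝ 1 (fun y => -(y * deriv χ y)) := (contDiff_id.mul hdχ).neg
    have hq : ContDiff ℝ 1 (fun y => 1 - χ y) := contDiff_const.sub hχ1'
    have hPc : HasCompactSupport (fun y => y * deriv ψ y) := hψc.deriv.mul_left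
    have hQc : HasCompactSupport (fun y => -(y * deriv χ y)) :=
      (hχc.deriv.mul_left (f := fun y => y)).neg
    have hqd : deriv (fun y => 1 - χ y) = fun y => -deriv χ y := by
      ext y; simp
    have hqc : HasCompactSupport (deriv (fun y => 1 - χ y)) := by
      rw [hqd]; exact hχc.deriv.neg
    obtain ⟨A1, hA1⟩ := aux_bdd _ hψ1'.continuous hψc
    obtain ⟨A2, hA2⟩ := aux_bdd _ hχ1'.continuous hχc
    obtain ⟨A3, hA3⟩ := aux_bdd _ hP.continuous hPc
    obtain ⟨A4, hA4⟩ := aux_bdd _ hQ.continuous hQc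
    have hA5 : ∀ x, |1 - χ x| ≤ 1 + A2 := fun x => by
      have := abs_sub (1:ℝ) (χ x)
      rw [abs_one] at this
      linarith [hA2 x]
    obtain ⟨C1, hC1⟩ := aux_amp ψ (fun y => 1 - χ y) hψ1' hq hψc.deriv hqc _ _ hA1 hA5
    obtain ⟨C2, hC2⟩ := aux_amp _ (fun y => 1 - χ y) hP hq hPc.deriv hqc _ _ hA3 hA5
    obtain ⟨C3, hC3⟩ := aux_amp ψ _ hψ1' hQ hψc.deriv hQc.deriv _ _ hA1 hA4
    refine ⟨C1 + (C2 + C3), fun t a L ht hL => ?_⟩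
    have ht0 : 0 < t := by linarith
    have hL0 : 0 < L := by linarith
    have cψ := hψ1'.continuous
    have cχ := hχ1'.continuous
    have cdψ := hdψ.continuous
    have cdχ := hdχ.continuous
    have hm := aux_main t a (3 * L) (C1 / Real.sqrt t) (C2 / Real.sqrt t + C3 / Real.sqrt t) ht0
      (by linarith) (fun x => ψ (x / L) * (1 - χ (x / lam0)))
      (fun x => deriv ψ (x / L) / L * (1 - χ (x / lam0)) +
        ψ (x / L) * -(deriv χ (x / lam0) / lam0))
      (fun x => (aux_dilder ψ hψ1' L x).mul ((aux_dilder χ hχ1' lam0 x).const_sub 1))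
      (by fun_prop) ?_ ?_ ?_
    · rw [← add_div, ← add_div] at hm
      exact hm
    · intro x hx
      have : ψ (x / L) = 0 := by
        by_contra hne
        have h2 := (hψs hne).2
        rw [div_le_iff₀ hL0] at h2
        linarith
      simp [this]
    · intro b
      exact hC1 t b L lam0 (3 * L) ht0 hL0 hlam0 (by linarith)
    · intro b
      have h2 := hC2 t b L lam0 (3 * L) ht0 hL0 hlam0 (by linarith)
      have h3 := hC3 t b L lam0 (3 * L) ht0 hL0 hlam0 (by linarith)
      refine le_trans (le_of_eq ?_) ((norm_add_le _ _).trans (add_le_add h2 h3))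
      rw [← intervalIntegral.integral_add
        ((by fun_prop : Continuous _).intervalIntegrable _ _)
        ((by fun_prop : Continuous _).intervalIntegrable _ _)]
      congr 2
      ext x
      push_cast
      ring
  refine ⟨C, fun t a L ht hL => ?_⟩
  have ht0 : 0 < t := by linarith
  have h := hC t a L ht hL
  have e : C / Real.sqrt t / t = C * t ^ (-(3 : ℝ) / 2) := by
    rw [show (-(3:ℝ)/2) = -(1/2 + 1) by norm_num, Real.rpow_neg ht0.le, Real.rpow_add ht0,
      Real.rpow_one, ← Real.sqrt_eq_rpow]
    field_simp
  rw [e] at h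
  simpa only [mul_assoc] using h
end

section
/- Let σ > 1. There is a constant C, depending only on σ, such that for every y ∈ ℝ³ and every ρ > 0: ρ² ∫_{S²} ⟨y + ρω⟩^{-2σ} dω ≤ C ⟨ρ − |y|⟩^{2−2σ}, where dω is the standard surface measure on the unit sphere S² ⊂ ℝ³. -/
open MeasureTheory

noncomputable section

abbrev E3 : Type := EuclideanSpace ℝ (Fin 3)

/-- The Japanese bracket `⟨x⟩ = (1 + |x|²)^{1/2}`. -/
def jap (x : E3) : ℝ := Real.sqrt (1 + ‖x‖ ^ 2)

open scoped Pointwise in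
theorem cap_bound (e : E3) (he : ‖e‖ = 1) (s : ℝ) (hs : 0 < s) :
    (volume : Measure E3).toSphere {ω : Metric.sphere (0 : E3) 1 | ‖(ω : E3) + e‖ < s} ≤
      ENNReal.ofReal (48 * s ^ 2) * volume (Metric.ball (0 : E3) 1) := by
  have hmeas : MeasurableSet {ω : Metric.sphere (0 : E3) 1 | ‖(ω : E3) + e‖ < s} :=
    (isOpen_lt (by fun_prop) continuous_const).measurableSet
  rw [Measure.toSphere_apply' _ hmeas]
  have hdim : Module.finrank ℝ E3 = 3 := by simp [E3]
  rw [hdim]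
  have key : volume (Set.Ioo (0 : ℝ) 1 • ((↑) '' {ω : Metric.sphere (0 : E3) 1 | ‖(ω : E3) + e‖ < s} : Set E3))
      ≤ ENNReal.ofReal (16 * s ^ 2) * volume (Metric.ball (0 : E3) 1) := by
    rcases le_or_gt s 1 with h1 | h1
    · have hsub : (Set.Ioo (0 : ℝ) 1 • ((↑) '' {ω : Metric.sphere (0 : E3) 1 | ‖(ω : E3) + e‖ < s} : Set E3))
          ⊆ ⋃ k ∈ Finset.range ⌈1 / s⌉₊, Metric.ball (-((k : ℝ) * s) • e) (2 * s) := by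
        rintro x ⟨t, ⟨ht0, ht1⟩, w, ⟨ω, hω, rfl⟩, rfl⟩
        simp only [Set.mem_setOf_eq] at hω
        have hk1 := Nat.floor_le (div_nonneg ht0.le hs.le)
        have hk2 := Nat.lt_floor_add_one (t / s)
        rw [le_div_iff₀ hs] at hk1
        rw [div_lt_iff₀ hs] at hk2
        simp only [Set.mem_iUnion, Finset.mem_range, Metric.mem_ball]
        refine ⟨⌊t / s⌋₊, ?_, ?_⟩
        · rw [Nat.floor_lt (div_nonneg ht0.le hs.le)]
          exact lt_of_lt_of_le (div_lt_div_of_pos_right ht1 hs) (Nat.le_ceil _)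
        · rw [dist_eq_norm]
          have : t • (ω : E3) - (-((⌊t / s⌋₊ : ℝ) * s) • e)
              = t • ((ω : E3) + e) - (t - (⌊t / s⌋₊ : ℝ) * s) • e := by
            module
          show ‖t • (ω : E3) - (-((⌊t / s⌋₊ : ℝ) * s) • e)‖ < 2 * s
          rw [this]
          refine (norm_sub_le _ _).trans_lt ?_
          rw [norm_smul, norm_smul, he, Real.norm_of_nonneg ht0.le,
            Real.norm_of_nonneg (by linarith)]
          have : t * ‖(ω : E3) + e‖ ≤ 1 * ‖(ω : E3) + e‖ :=
            mul_le_mul_of_nonneg_right ht1.le (norm_nonneg _)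
          linarith
      refine (measure_mono hsub).trans ((measure_biUnion_finset_le _ _).trans ?_)
      have hb : ∀ k : ℕ, volume (Metric.ball (-((k : ℝ) * s) • e) (2 * s)) =
          ENNReal.ofReal ((2 * s) ^ 3) * volume (Metric.ball (0 : E3) 1) := by
        intro k
        rw [Measure.addHaar_ball _ _ (by positivity), hdim]
      simp only [hb]
      rw [Finset.sum_const, Finset.card_range, nsmul_eq_mul, ← mul_assoc]
      gcongr
      rw [← ENNReal.ofReal_natCast, ← ENNReal.ofReal_mul (by positivity)]
      apply ENNReal.ofReal_le_ofReal
      have h2 : (⌈1 / s⌉₊ : ℝ) < 1 / s + 1 := Nat.ceil_lt_add_one (by positivity)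
      have h3 : (⌈1 / s⌉₊ : ℝ) * s ≤ 2 := by
        have := mul_le_mul_of_nonneg_right h2.le hs.le
        rw [add_mul, div_mul_cancel₀ _ hs.ne'] at this
        linarith
      nlinarith [mul_le_mul_of_nonneg_right h3 (sq_nonneg s)]
    · have hsub : (Set.Ioo (0 : ℝ) 1 • ((↑) '' {ω : Metric.sphere (0 : E3) 1 | ‖(ω : E3) + e‖ < s} : Set E3))
          ⊆ Metric.ball (0 : E3) 1 := by
        rintro x ⟨t, ⟨ht0, ht1⟩, w, ⟨ω, hω, rfl⟩, rfl⟩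
        have hn : ‖(ω : E3)‖ = 1 := by simpa using ω.2
        rw [mem_ball_zero_iff]
        show ‖t • (ω : E3)‖ < 1
        rw [norm_smul, hn, Real.norm_of_nonneg ht0.le]
        linarith
      refine (measure_mono hsub).trans ?_
      refine le_mul_of_one_le_left (zero_le) ?_
      rw [ENNReal.one_le_ofReal]
      nlinarith
  calc _ ≤ ((3 : ℕ) : ENNReal) * (ENNReal.ofReal (16 * s ^ 2) * volume (Metric.ball (0 : E3) 1)) := by
        gcongr
    _ = _ := by
        rw [← mul_assoc, ← ENNReal.ofReal_natCast, ← ENNReal.ofReal_mul (by positivity)]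
        congr 2
        push_cast
        ring

theorem exists_dir (y : E3) : ∃ e : E3, ‖e‖ = 1 ∧ y = ‖y‖ • e := by
  by_cases hy : y = 0
  · obtain ⟨e, he⟩ := exists_norm_eq E3 (zero_le_one (α := ℝ))
    exact ⟨e, he, by simp [hy]⟩
  · have : ‖y‖ ≠ 0 := norm_ne_zero_iff.2 hy
    refine ⟨‖y‖⁻¹ • y, ?_, ?_⟩
    · rw [norm_smul, norm_inv, norm_norm, inv_mul_cancel₀ this]
    · rw [smul_smul, mul_inv_cancel₀ this, one_smul]

theorem level_bound (y : E3) (ρ : ℝ) (hρ : 0 < ρ) (B : ℝ) (hB : 0 < B) :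
    ENNReal.ofReal (ρ ^ 2) * (volume : Measure E3).toSphere
      {ω : Metric.sphere (0 : E3) 1 | 1 + ‖y + ρ • (ω : E3)‖ ^ 2 < B} ≤
      ENNReal.ofReal (192 * B) * volume (Metric.ball (0 : E3) 1) := by
  obtain ⟨e, he, hy⟩ := exists_dir y
  have hsub : {ω : Metric.sphere (0 : E3) 1 | 1 + ‖y + ρ • (ω : E3)‖ ^ 2 < B} ⊆
      {ω : Metric.sphere (0 : E3) 1 | ‖(ω : E3) + e‖ < 2 * √B / ρ} := by
    intro ω hω
    simp only [Set.mem_setOf_eq] at hω ⊢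
    have hn : ‖(ω : E3)‖ = 1 := by simpa using ω.2
    have h1 : ‖y + ρ • (ω : E3)‖ < √B := Real.lt_sqrt_of_sq_lt (by linarith)
    have h2 : |ρ - ‖y‖| ≤ ‖y + ρ • (ω : E3)‖ := by
      have := abs_norm_sub_norm_le (ρ • (ω : E3)) (-y)
      rw [norm_neg, norm_smul, hn, Real.norm_of_nonneg hρ.le, sub_neg_eq_add, add_comm _ y,
        mul_one] at this
      exact this
    have h3 : ρ • ((ω : E3) + e) = (y + ρ • (ω : E3)) + (ρ - ‖y‖) • e := by
      nth_rewrite 1 [hy]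
      module
    have h4 := norm_add_le (y + ρ • (ω : E3)) ((ρ - ‖y‖) • e)
    rw [← h3, norm_smul, norm_smul, he, Real.norm_of_nonneg hρ.le, Real.norm_eq_abs] at h4
    rw [lt_div_iff₀ hρ]
    linarith
  calc _ ≤ ENNReal.ofReal (ρ ^ 2) * (ENNReal.ofReal (48 * (2 * √B / ρ) ^ 2) *
          volume (Metric.ball (0 : E3) 1)) := by
        gcongr
        exact (measure_mono hsub).trans (cap_bound e he _ (by positivity))
    _ = _ := by
        rw [← mul_assoc, ← ENNReal.ofReal_mul (by positivity)]
        congr 2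
        rw [div_pow, mul_pow, Real.sq_sqrt hB.le]
        field_simp
        norm_num

theorem stmt_13 (σ : ℝ) (hσ : 1 < σ) :
    ∃ C : ℝ, ∀ (y : E3) (ρ : ℝ), 0 < ρ →
      ENNReal.ofReal (ρ ^ 2) *
        (∫⁻ ω : Metric.sphere (0 : E3) 1,
          ENNReal.ofReal (jap (y + ρ • (ω : E3)) ^ (-(2 : ℝ) * σ))
          ∂((volume : Measure E3).toSphere))
        ≤ ENNReal.ofReal (C * Real.sqrt (1 + (ρ - ‖y‖) ^ 2) ^ (2 - 2 * σ)) := by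
  set V : ℝ := (volume (Metric.ball (0 : E3) 1)).toReal with hV
  have hVV : volume (Metric.ball (0 : E3) 1) = ENNReal.ofReal V :=
    (ENNReal.ofReal_toReal measure_ball_lt_top.ne).symm
  have hV0 : 0 ≤ V := ENNReal.toReal_nonneg
  set q : ℝ := (4 : ℝ) ^ (1 - σ) with hq
  have hq0 : 0 < q := by positivity
  have hq1 : q < 1 := Real.rpow_lt_one_of_one_lt_of_neg (by norm_num) (by linarith)
  have hsum : Summable fun k : ℕ => q ^ k := summable_geometric_of_lt_one hq0.le hq1
  refine ⟨768 * V * ∑' k : ℕ, q ^ k, fun y ρ hρ => ?_⟩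
  set A : ℝ := 1 + (ρ - ‖y‖) ^ 2 with hA
  have hA0 : 0 < A := by positivity
  have hAs : √A ^ (2 - 2 * σ) = A ^ (1 - σ) := by
    rw [Real.sqrt_eq_rpow, ← Real.rpow_mul hA0.le]
    congr 1
    ring
  rw [hAs]
  let S : ℕ → Set (Metric.sphere (0 : E3) 1) :=
    fun k => {ω | 1 + ‖y + ρ • (ω : E3)‖ ^ 2 < 4 ^ (k + 1) * A}
  have hS : ∀ k, MeasurableSet (S k) := fun k =>
    (isOpen_lt (by fun_prop) continuous_const).measurableSet
  let c : ℕ → ENNReal := fun k => ENNReal.ofReal ((4 ^ k * A) ^ (-σ))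
  have hpt : ∀ ω : Metric.sphere (0 : E3) 1,
      ENNReal.ofReal (jap (y + ρ • (ω : E3)) ^ (-(2 : ℝ) * σ)) ≤
        ∑' k, (S k).indicator (fun _ => c k) ω := by
    intro ω
    have hn : ‖(ω : E3)‖ = 1 := by simpa using ω.2
    have h2 : |ρ - ‖y‖| ≤ ‖y + ρ • (ω : E3)‖ := by
      have := abs_norm_sub_norm_le (ρ • (ω : E3)) (-y)
      rw [norm_neg, norm_smul, hn, Real.norm_of_nonneg hρ.le, sub_neg_eq_add, add_comm _ y,
        mul_one] at this
      exact this
    set f : ℝ := 1 + ‖y + ρ • (ω : E3)‖ ^ 2 with hf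
    have hf0 : 0 < f := by positivity
    have hAf : A ≤ f := by
      have := sq_le_sq' (by linarith [abs_nonneg (ρ - ‖y‖), norm_nonneg (y + ρ • (ω : E3))]) h2
      rw [sq_abs] at this
      linarith
    obtain ⟨k, hk1, hk2⟩ := exists_nat_pow_near (x := f / A) (y := 4)
      ((one_le_div hA0).2 hAf) (by norm_num)
    rw [le_div_iff₀ hA0] at hk1
    rw [div_lt_iff₀ hA0] at hk2
    refine le_trans ?_ (ENNReal.le_tsum k)
    have hmem : ω ∈ S k := hk2
    rw [Set.indicator_of_mem hmem]
    apply ENNReal.ofReal_le_ofReal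
    have : jap (y + ρ • (ω : E3)) ^ (-(2 : ℝ) * σ) = f ^ (-σ) := by
      unfold jap
      rw [← hf, Real.sqrt_eq_rpow, ← Real.rpow_mul hf0.le]
      congr 1
      ring
    rw [this]
    exact Real.rpow_le_rpow_of_nonpos (by positivity) hk1 (by linarith)
  calc _ ≤ ENNReal.ofReal (ρ ^ 2) * ∫⁻ ω : Metric.sphere (0 : E3) 1,
          ∑' k, (S k).indicator (fun _ => c k) ω ∂((volume : Measure E3).toSphere) := by
        gcongr with ω
        exact hpt ω
    _ = ∑' k, c k * (ENNReal.ofReal (ρ ^ 2) * (volume : Measure E3).toSphere (S k)) := by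
        rw [lintegral_tsum fun k => (measurable_const.indicator (hS k)).aemeasurable,
          ← ENNReal.tsum_mul_left]
        congr 1
        ext k
        rw [lintegral_indicator_const (hS k)]
        ring
    _ ≤ ∑' k, ENNReal.ofReal (768 * V * A ^ (1 - σ) * q ^ k) := by
        refine ENNReal.tsum_le_tsum fun k => ?_
        refine (mul_le_mul_right (level_bound y ρ hρ (4 ^ (k + 1) * A) (by positivity)) _).trans ?_
        rw [hVV, ← ENNReal.ofReal_mul (by positivity), ← ENNReal.ofReal_mul (by positivity)]
        apply ENNReal.ofReal_le_ofReal
        apply le_of_eq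
        have e1 : A ^ (1 - σ) = A * A ^ (-σ) := by
          rw [sub_eq_add_neg, Real.rpow_add hA0, Real.rpow_one]
        have e2 : q ^ k = 4 ^ k * ((4 : ℝ) ^ k) ^ (-σ) := by
          rw [hq, ← Real.rpow_natCast, ← Real.rpow_natCast, ← Real.rpow_mul (by norm_num),
            ← Real.rpow_mul (by norm_num), ← Real.rpow_add (by norm_num)]
          congr 1
          ring
        rw [e1, e2, Real.mul_rpow (by positivity) hA0.le]
        ring
    _ = _ := by
        rw [← ENNReal.ofReal_tsum_of_nonneg (fun k => by positivity) (hsum.mul_left _),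
          tsum_mul_left]
        congr 1
        ring
end
end

section
/- Let σ > 3/2 and α > 1 (or symmetrically σ > 1 and α > 3/2). There is a constant C, depending only on σ and α, such that for every λ₀ ∈ (0, 1] and every differentiable function h : ℝ → ℂ satisfying |h(u)| ≤ λ₀ (1 + λ₀|u|)^{-10} and |h'(u)| ≤ λ₀² (1 + λ₀|u|)^{-10} for all u ∈ ℝ, the kernel K_u(x, y) = ( h(u + |x − y|) − h(u) ) / |x − y| satisfies ∫_ℝ ( ∫_{ℝ³} ∫_{ℝ³} ⟨x⟩^{-2σ} |K_u(x, y)|² ⟨y⟩^{-2α} dx dy )^{1/2} du ≤ C λ₀^{1/2}. -/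
open MeasureTheory

noncomputable section

lemma aux_pow (a q : ℝ) (ha : 1 ≤ a) (hq2 : q ≤ 2) :
    a ^ q * (a ^ (-(10:ℝ))) ^ 2 ≤ a ^ (-q) := by
  have h0 : 0 < a := by linarith
  rw [← Real.rpow_natCast (a ^ (-(10:ℝ))) 2, ← Real.rpow_mul h0.le, ← Real.rpow_add h0]
  apply Real.rpow_le_rpow_of_exponent_le ha
  push_cast; linarith

lemma aux_point (l q r u : ℝ) (hl : 0 < l) (hq1 : 1 ≤ q) (hq2 : q ≤ 2) (hr : 0 < r)
    (h : ℝ → ℂ) (hd : Differentiable ℝ h)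
    (h1 : ∀ u : ℝ, ‖h u‖ ≤ l * (1 + l * |u|) ^ (-(10 : ℝ)))
    (h2 : ∀ u : ℝ, ‖deriv h u‖ ≤ l ^ 2 * (1 + l * |u|) ^ (-(10 : ℝ))) :
    (1 + l * |u|) ^ q * ‖(h (u + r) - h u) / ((r : ℝ) : ℂ)‖ ^ 2 ≤
      2 ^ 21 * (l ^ 2 / r ^ 2) * (l * r) ^ q *
        ((1 + l * |u|) ^ (-q) + (1 + l * |u + r|) ^ (-q)) := by
  have ha : 1 ≤ 1 + l * |u| := by nlinarith [abs_nonneg u]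
  have hb : 1 ≤ 1 + l * |u + r| := by nlinarith [abs_nonneg (u + r)]
  have hA := aux_pow _ q ha hq2
  have hB := aux_pow _ q hb hq2
  have hlr : 0 < l * r := by positivity
  rw [norm_div, div_pow, Complex.norm_real, Real.norm_of_nonneg hr.le]
  rcases le_total (l * r) 1 with hc | hc
  · have hK : ‖h (u + r) - h u‖ ≤ (l ^ 2 * (2 ^ 10 * (1 + l * |u|) ^ (-(10:ℝ)))) * r := by
      have := Convex.norm_image_sub_le_of_norm_deriv_le (𝕜 := ℝ) (f := h) (s := Set.Icc u (u + r))
        (x := u) (y := u + r) (C := l ^ 2 * (2 ^ 10 * (1 + l * |u|) ^ (-(10:ℝ))))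
        (fun x _ => hd x) ?_ (convex_Icc _ _) (by simp [hr.le]) (by simp [hr.le])
      · simpa [abs_of_pos hr] using this
      · intro x hx
        refine (h2 x).trans ?_
        gcongr
        have hux : |u| ≤ |x| + r := by
          have := abs_sub_abs_le_abs_sub u x
          have h3 : |u - x| ≤ r := by rw [abs_le]; constructor <;> linarith [hx.1, hx.2]
          linarith
        have h5 : (1 + l * |u|) / 2 ≤ 1 + l * |x| := by
          nlinarith [abs_nonneg x, mul_le_mul_of_nonneg_left hux hl.le, mul_nonneg hl.le (abs_nonneg x)]
        have h4 := Real.rpow_le_rpow_of_nonpos (z := -(10:ℝ)) (by positivity) h5 (by norm_num)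
        refine h4.trans (le_of_eq ?_)
        rw [Real.div_rpow (by positivity) (by norm_num), Real.rpow_neg (x := 2) (by norm_num)]
        rw [show ((2:ℝ) ^ (10:ℝ)) = 2 ^ 10 by norm_num]
        field_simp
    have hK2 : ‖h (u + r) - h u‖ ^ 2 / r ^ 2 ≤ 2 ^ 20 * l ^ 4 * ((1 + l * |u|) ^ (-(10:ℝ))) ^ 2 := by
      rw [div_le_iff₀ (by positivity)]
      calc _ ≤ ((l ^ 2 * (2 ^ 10 * (1 + l * |u|) ^ (-(10:ℝ)))) * r) ^ 2 := by gcongr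
        _ = _ := by ring
    have hq : (l * r) ^ 2 ≤ (l * r) ^ q := by
      rw [← Real.rpow_natCast]
      exact Real.rpow_le_rpow_of_exponent_ge hlr hc (by simpa using hq2)
    calc _ ≤ (1 + l * |u|) ^ q * (2 ^ 20 * l ^ 4 * ((1 + l * |u|) ^ (-(10:ℝ))) ^ 2) := by gcongr
      _ = 2 ^ 20 * (l ^ 2 / r ^ 2) * (l * r) ^ 2 * ((1 + l * |u|) ^ q * ((1 + l * |u|) ^ (-(10:ℝ))) ^ 2) := by
        field_simp
      _ ≤ 2 ^ 21 * (l ^ 2 / r ^ 2) * (l * r) ^ q * ((1 + l * |u|) ^ (-q) + (1 + l * |u + r|) ^ (-q)) := by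
        have : (0:ℝ) ≤ (1 + l * |u + r|) ^ (-q) := by positivity
        gcongr ?_ * _ * ?_ * ?_
        · norm_num
        · linarith
  · have hK : ‖h (u + r) - h u‖ ^ 2 ≤ 2 * l ^ 2 *
        (((1 + l * |u|) ^ (-(10:ℝ))) ^ 2 + ((1 + l * |u + r|) ^ (-(10:ℝ))) ^ 2) := by
      have h3 : ‖h (u + r) - h u‖ ≤ l * (1 + l * |u + r|) ^ (-(10 : ℝ)) + l * (1 + l * |u|) ^ (-(10 : ℝ)) :=
        (norm_sub_le _ _).trans (add_le_add (h1 _) (h1 _))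
      calc _ ≤ (l * (1 + l * |u + r|) ^ (-(10 : ℝ)) + l * (1 + l * |u|) ^ (-(10 : ℝ))) ^ 2 := by gcongr
        _ ≤ _ := by nlinarith [sq_nonneg (l * (1 + l * |u + r|) ^ (-(10 : ℝ)) - l * (1 + l * |u|) ^ (-(10 : ℝ)))]
    have hq : 1 ≤ (l * r) ^ q := Real.one_le_rpow hc (by linarith)
    have hab : (1 + l * |u|) ^ q ≤ 4 * ((l * r) ^ q * (1 + l * |u + r|) ^ q) := by
      have h5 : 1 + l * |u| ≤ 2 * ((l * r) * (1 + l * |u + r|)) := by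
        have hux : |u| ≤ |u + r| + r := by
          have := abs_sub_abs_le_abs_sub u (u + r)
          have h3 : |u - (u + r)| ≤ r := by simp [abs_of_pos hr]
          linarith
        nlinarith [mul_le_mul_of_nonneg_left hux hl.le, mul_nonneg hl.le (abs_nonneg (u+r)),
          mul_nonneg (sub_nonneg.2 hc) (mul_nonneg hl.le (abs_nonneg (u+r)))]
      calc _ ≤ (2 * ((l * r) * (1 + l * |u + r|))) ^ q := by gcongr
        _ = 2 ^ q * ((l * r) ^ q * (1 + l * |u + r|) ^ q) := by
          rw [Real.mul_rpow (by norm_num) (by positivity), Real.mul_rpow (by positivity) (by positivity)]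
        _ ≤ _ := by
          gcongr
          calc (2:ℝ) ^ q ≤ 2 ^ (2:ℝ) := Real.rpow_le_rpow_of_exponent_le (by norm_num) hq2
            _ = 4 := by norm_num
    set a := 1 + l * |u|
    set b := 1 + l * |u + r|
    set A := a ^ (-(10:ℝ))
    set B := b ^ (-(10:ℝ))
    have e1 : a ^ q * A ^ 2 ≤ (l * r) ^ q * a ^ (-q) := by
      have : 0 ≤ a ^ (-q) := by positivity
      nlinarith
    have e2 : a ^ q * B ^ 2 ≤ 4 * ((l * r) ^ q * b ^ (-q)) := by
      calc _ ≤ 4 * ((l * r) ^ q * b ^ q) * B ^ 2 := by gcongr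
        _ = 4 * ((l * r) ^ q * (b ^ q * B ^ 2)) := by ring
        _ ≤ _ := by gcongr
    calc _ ≤ a ^ q * ((2 * l ^ 2 * (A ^ 2 + B ^ 2)) / r ^ 2) := by gcongr
      _ = 2 * (l ^ 2 / r ^ 2) * (a ^ q * A ^ 2 + a ^ q * B ^ 2) := by ring
      _ ≤ 2 * (l ^ 2 / r ^ 2) * ((l * r) ^ q * a ^ (-q) + 4 * ((l * r) ^ q * b ^ (-q))) := by gcongr
      _ ≤ 2 * (l ^ 2 / r ^ 2) * (2 ^ 20 * ((l * r) ^ q * a ^ (-q)) + 2 ^ 20 * ((l * r) ^ q * b ^ (-q))) := by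
        have : 0 ≤ (l * r) ^ q * a ^ (-q) := by positivity
        have h9 : 0 ≤ (l * r) ^ q * b ^ (-q) := by positivity
        apply mul_le_mul_of_nonneg_left _ (by positivity)
        linarith
      _ = _ := by ring

lemma one_le_jap (x : E3) : 1 ≤ jap x := by
  unfold jap
  rw [Real.one_le_sqrt]
  nlinarith [sq_nonneg ‖x‖]

lemma measurable_jap : Measurable jap := by
  unfold jap
  fun_prop

lemma jap_integrable (p : ℝ) (hp : 3 < p) : Integrable (fun x : E3 => jap x ^ (-p)) := by
  have := integrable_rpow_neg_one_add_norm_sq (E := E3) (μ := volume) (r := p) (by simpa using hp)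
  refine this.congr (Filter.Eventually.of_forall fun x => ?_)
  simp only [jap]
  rw [Real.sqrt_eq_rpow, ← Real.rpow_mul (by positivity)]
  congr 1; ring

lemma ball_integrable (s : ℝ) (hs : s < 1) :
    Integrable ((Metric.ball (0 : E3) 1).indicator (fun z : E3 => ‖z‖ ^ (-s))) := by
  rw [integrable_indicator_iff measurableSet_ball]
  rw [integrableOn_fun_norm_addHaar volume (f := fun t : ℝ => t ^ (-s))]
  have h := (intervalIntegral.intervalIntegrable_rpow' (a := 0) (b := 1) (r := 2 - s) (by linarith)).1
  have h2 := h.mono_set Set.Ioo_subset_Ioc_self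
  refine h2.congr_fun (fun x hx => ?_) measurableSet_Ioo
  have : 0 < x := hx.1
  simp only [finrank_euclideanSpace, Fintype.card_fin, smul_eq_mul]
  rw [← Real.rpow_natCast, ← Real.rpow_add this]
  norm_num; ring_nf

lemma aux_unif (s α : ℝ) (hs0 : 0 < s) (hs1 : s < 1) (hα : 0 < α) (hp : 3 < 2 * α + s) :
    ∃ C : ENNReal, C ≠ ⊤ ∧ ∀ x : E3,
      ∫⁻ y : E3, ENNReal.ofReal (‖x - y‖ ^ (-s) * jap y ^ (-(2:ℝ) * α)) ≤ C := by
  set p := 2 * α + s with hpdef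
  let ψ : E3 → ℝ := fun z => (Metric.ball (0 : E3) 1).indicator (fun z : E3 => ‖z‖ ^ (-s)) z
      + 2 ^ p * (1 + ‖z‖) ^ (-p)
  have hψ : Integrable ψ := by
    refine (ball_integrable s hs1).add (Integrable.const_mul ?_ _)
    exact integrable_one_add_norm (by simpa using hp)
  have hi0 : ∀ z : E3, 0 ≤ (Metric.ball (0 : E3) 1).indicator (fun z : E3 => ‖z‖ ^ (-s)) z :=
    fun z => Set.indicator_nonneg (fun _ _ => by positivity) z
  have hψ0 : ∀ z, 0 ≤ ψ z := fun z => add_nonneg (hi0 z) (by positivity)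
  have hJ := jap_integrable p hp
  refine ⟨(∫⁻ y : E3, ENNReal.ofReal (jap y ^ (-p))) + ∫⁻ z, ENNReal.ofReal (ψ z), ?_, ?_⟩
  · exact ENNReal.add_ne_top.2 ⟨hJ.lintegral_lt_top.ne, hψ.lintegral_lt_top.ne⟩
  · intro x
    rw [← lintegral_sub_left_eq_self (fun z => ENNReal.ofReal (ψ z)) x,
      ← lintegral_add_left (measurable_jap.pow_const _).ennreal_ofReal]
    refine lintegral_mono fun y => ?_
    have hj := one_le_jap y
    have hj0 : 0 < jap y := by linarith
    rw [← ENNReal.ofReal_add (by positivity) (hψ0 _)]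
    apply ENNReal.ofReal_le_ofReal
    have hJ0 : 0 ≤ jap y ^ (-p) := by positivity
    generalize hz : x - y = z
    have hr0 : 0 ≤ (2:ℝ) ^ p * (1 + ‖z‖) ^ (-p) := by positivity
    rcases lt_or_ge ‖z‖ 1 with h1 | h1
    · have : ‖z‖ ^ (-s) * jap y ^ (-(2:ℝ) * α) ≤ ‖z‖ ^ (-s) :=
        mul_le_of_le_one_right (by positivity)
          (Real.rpow_le_one_of_one_le_of_nonpos hj (by linarith))
      have h2 : ψ z = ‖z‖ ^ (-s) + 2 ^ p * (1 + ‖z‖) ^ (-p) := by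
        simp only [ψ]
        rw [Set.indicator_of_mem (by simpa using h1)]
      linarith
    · have hz0 : 0 < ‖z‖ := by linarith
      rcases le_total (jap y) ‖z‖ with h3 | h3
      · have h4 : ‖z‖ ^ (-s) * jap y ^ (-(2:ℝ) * α) ≤ jap y ^ (-s) * jap y ^ (-(2:ℝ) * α) := by
          apply mul_le_mul_of_nonneg_right _ (by positivity)
          exact Real.rpow_le_rpow_of_nonpos hj0 h3 (by linarith)
        rw [← Real.rpow_add hj0, show -s + -(2:ℝ) * α = -p by rw [hpdef]; ring] at h4
        linarith [hψ0 z]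
      · have h4 : ‖z‖ ^ (-s) * jap y ^ (-(2:ℝ) * α) ≤ ‖z‖ ^ (-s) * ‖z‖ ^ (-(2:ℝ) * α) := by
          apply mul_le_mul_of_nonneg_left _ (by positivity)
          exact Real.rpow_le_rpow_of_nonpos hz0 h3 (by linarith)
        rw [← Real.rpow_add hz0, show -s + -(2:ℝ) * α = -p by rw [hpdef]; ring] at h4
        have h5 : ‖z‖ ^ (-p) ≤ ((1 + ‖z‖) / 2) ^ (-p) :=
          Real.rpow_le_rpow_of_nonpos (by positivity) (by linarith) (by linarith)
        rw [Real.div_rpow (by positivity) (by norm_num), Real.rpow_neg (x := 2) (by norm_num),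
          div_inv_eq_mul, mul_comm] at h5
        have : ψ z = _ + _ := rfl
        linarith [hi0 z]

lemma aux_double (s σ α : ℝ) (hs0 : 0 < s) (hs1 : s < 1) (hα : 0 < α) (hp : 3 < 2 * α + s)
    (hσ : 3 / 2 < σ) :
    ∫⁻ x : E3, ∫⁻ y : E3, ENNReal.ofReal
      (jap x ^ (-(2:ℝ) * σ) * ‖x - y‖ ^ (-s) * jap y ^ (-(2:ℝ) * α)) ≠ ⊤ := by
  obtain ⟨C, hC, hb⟩ := aux_unif s α hs0 hs1 hα hp
  have hJ := (jap_integrable (2 * σ) (by linarith)).lintegral_lt_top.ne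
  refine ne_top_of_le_ne_top (ENNReal.mul_ne_top hJ hC) ?_
  rw [← lintegral_mul_const' _ _ hC]
  refine lintegral_mono fun x => ?_
  have hj : 0 < jap x := lt_of_lt_of_le one_pos (one_le_jap x)
  calc _ = ∫⁻ y : E3, ENNReal.ofReal (jap x ^ (-(2 * σ))) *
        ENNReal.ofReal (‖x - y‖ ^ (-s) * jap y ^ (-(2:ℝ) * α)) := by
        refine lintegral_congr fun y => ?_
        rw [← ENNReal.ofReal_mul (by positivity), neg_mul, mul_assoc]
    _ ≤ _ := by
      rw [lintegral_const_mul' _ _ ENNReal.ofReal_ne_top]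
      gcongr
      exact hb x

lemma aux_double' (σ α : ℝ) (hσα : (3 / 2 < σ ∧ 1 < α) ∨ (1 < σ ∧ 3 / 2 < α)) :
    ∃ q : ℝ, 1 < q ∧ q < 2 ∧ ∫⁻ x : E3, ∫⁻ y : E3, ENNReal.ofReal
      (jap x ^ (-(2:ℝ) * σ) * ‖x - y‖ ^ (-(2 - q)) * jap y ^ (-(2:ℝ) * α)) ≠ ⊤ := by
  rcases hσα with ⟨h1, h2⟩ | ⟨h1, h2⟩
  · have hm : min (1/2) (α - 1) ≤ 1/2 := min_le_left _ _
    have hm' : min (1/2) (α - 1) ≤ α - 1 := min_le_right _ _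
    have hm0 : 0 < min (1/2) (α - 1) := lt_min (by norm_num) (by linarith)
    refine ⟨1 + min (1/2) (α - 1), by linarith, by linarith,
      aux_double _ _ _ (by linarith) (by linarith) (by linarith) (by linarith) h1⟩
  · have hm : min (1/2) (σ - 1) ≤ 1/2 := min_le_left _ _
    have hm' : min (1/2) (σ - 1) ≤ σ - 1 := min_le_right _ _
    have hm0 : 0 < min (1/2) (σ - 1) := lt_min (by norm_num) (by linarith)
    refine ⟨1 + min (1/2) (σ - 1), by linarith, by linarith, ?_⟩
    rw [lintegral_lintegral_swap]
    · have := aux_double (2 - (1 + min (1/2) (σ - 1))) α σ (by linarith) (by linarith)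
        (by linarith) (by linarith) h2
      convert this using 6 with y x
      rw [norm_sub_rev x y]; ring
    · have := measurable_jap
      apply Measurable.aemeasurable
      unfold Function.uncurry
      fun_prop

lemma aux_scale_s15 (l q : ℝ) (hl : 0 < l) (hq : 1 < q) :
    ∫⁻ u : ℝ, ENNReal.ofReal ((1 + l * |u|) ^ (-q)) =
      ENNReal.ofReal (l⁻¹ * ∫ u : ℝ, (1 + |u|) ^ (-q)) := by
  have hi : Integrable (fun u : ℝ => (1 + |u|) ^ (-q)) := by
    have := integrable_one_add_norm (E := ℝ) (μ := volume) (r := q) (by simpa using hq)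
    simpa using this
  have h2 := hi.comp_mul_left' hl.ne'
  have h3 := Measure.integral_comp_mul_left (fun u : ℝ => (1 + |u|) ^ (-q)) l
  simp only [abs_mul, abs_of_pos hl] at h2 h3
  rw [← ofReal_integral_eq_lintegral_ofReal h2
    (Filter.Eventually.of_forall fun u => by positivity), h3]
  simp [abs_of_pos hl]

lemma aux_amgm (F : ENNReal) (A : ℝ) (hA : 0 < A) :
    F ^ ((1:ℝ)/2) ≤ ENNReal.ofReal A + ENNReal.ofReal A⁻¹ * F := by
  rcases le_total (F ^ ((1:ℝ)/2)) (ENNReal.ofReal A) with h | h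
  · exact h.trans le_self_add
  · refine le_trans ?_ le_add_self
    have hF : F = F ^ ((1:ℝ)/2) * F ^ ((1:ℝ)/2) := by
      rw [← ENNReal.rpow_add_of_nonneg _ _ (by norm_num) (by norm_num)]; norm_num
    calc F ^ ((1:ℝ)/2) = ENNReal.ofReal A⁻¹ * (ENNReal.ofReal A * F ^ ((1:ℝ)/2)) := by
          rw [← mul_assoc, ← ENNReal.ofReal_mul (by positivity), inv_mul_cancel₀ hA.ne']; simp
      _ ≤ ENNReal.ofReal A⁻¹ * (F ^ ((1:ℝ)/2) * F ^ ((1:ℝ)/2)) := by gcongr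
      _ = _ := by rw [← hF]

lemma aux_pt (l q u σ α : ℝ) (hl : 0 < l) (hl1 : l ≤ 1) (hq1 : 1 < q) (hq2 : q < 2)
    (h : ℝ → ℂ) (hd : Differentiable ℝ h)
    (h1 : ∀ u : ℝ, ‖h u‖ ≤ l * (1 + l * |u|) ^ (-(10 : ℝ)))
    (h2 : ∀ u : ℝ, ‖deriv h u‖ ≤ l ^ 2 * (1 + l * |u|) ^ (-(10 : ℝ))) (x y : E3) :
    ((l * Real.sqrt l) * (1 + l * |u|) ^ (-q))⁻¹ * (jap x ^ (-(2 : ℝ) * σ) *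
            ‖(h (u + ‖x - y‖) - h u) / ((‖x - y‖ : ℝ) : ℂ)‖ ^ 2 *
            jap y ^ (-(2 : ℝ) * α)) ≤
     (jap x ^ (-(2:ℝ) * σ) * ‖x - y‖ ^ (-(2 - q)) * jap y ^ (-(2:ℝ) * α)) *
      ((2 ^ 21 * (l * Real.sqrt l)) * ((1 + l * |u|) ^ (-q) + (1 + l * |u + ‖x - y‖|) ^ (-q))) := by
  have hjx : 0 < jap x := lt_of_lt_of_le one_pos (one_le_jap x)
  have hjy : 0 < jap y := lt_of_lt_of_le one_pos (one_le_jap y)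
  have ha : 0 < 1 + l * |u| := by positivity
  rcases (norm_nonneg (x - y)).eq_or_lt with h0 | h0
  · rw [← h0]; simp
    rw [Real.zero_rpow (by linarith)]; simp
  · have hp := aux_point l q _ u hl hq1.le hq2.le h0 h hd h1 h2
    set r := ‖x - y‖
    have e1 : (l ^ 2 / r ^ 2) * (l * r) ^ q ≤ l ^ 3 * r ^ (-(2 - q)) := by
      have e2 : l ^ q ≤ l := by
        simpa using Real.rpow_le_rpow_of_exponent_ge hl hl1 hq1.le
      have e3 : r ^ (-(2 - q)) = r ^ q / r ^ 2 := by
        rw [show -(2 - q) = q - (2 : ℕ) by push_cast; ring, Real.rpow_sub h0, Real.rpow_natCast]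
      rw [Real.mul_rpow hl.le h0.le, e3]
      calc _ = l ^ 2 * l ^ q * (r ^ q / r ^ 2) := by ring
        _ ≤ l ^ 2 * l * (r ^ q / r ^ 2) := by gcongr
        _ = _ := by ring
    have hs : Real.sqrt l ^ 2 = l := Real.sq_sqrt hl.le
    have hs0 : 0 < Real.sqrt l := Real.sqrt_pos.2 hl
    set t := Real.sqrt l
    set S := (1 + l * |u|) ^ (-q) + (1 + l * |u + r|) ^ (-q)
    set K := ‖(h (u + r) - h u) / (r : ℂ)‖ ^ 2
    have hS : 0 ≤ S := by positivity
    have e4 : (1 + l * |u|) ^ q * K ≤ 2 ^ 21 * (l ^ 3 * r ^ (-(2 - q))) * S := by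
      refine hp.trans ?_
      rw [mul_assoc (2 ^ 21) (l ^ 2 / r ^ 2)]
      gcongr
    rw [mul_inv, ← Real.rpow_neg ha.le, neg_neg]
    calc _ = (l * t)⁻¹ * (jap x ^ (-(2 : ℝ) * σ) * jap y ^ (-(2 : ℝ) * α)) * ((1 + l * |u|) ^ q * K) := by ring
      _ ≤ (l * t)⁻¹ * (jap x ^ (-(2 : ℝ) * σ) * jap y ^ (-(2 : ℝ) * α)) * (2 ^ 21 * (l ^ 3 * r ^ (-(2 - q))) * S) := by
        gcongr
      _ = _ := by
        have : (l * t)⁻¹ * l ^ 3 = l * t := by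
          field_simp
          rw [hs]
        calc _ = ((l * t)⁻¹ * l ^ 3) * ((jap x ^ (-(2 : ℝ) * σ) * jap y ^ (-(2 : ℝ) * α)) * (2 ^ 21 * (r ^ (-(2 - q))) * S)) := by ring
          _ = _ := by rw [this]; ring

theorem stmt_15 (σ α : ℝ)
    (hσα : (3 / 2 < σ ∧ 1 < α) ∨ (1 < σ ∧ 3 / 2 < α)) :
    ∃ C : ℝ, ∀ lam0 : ℝ, lam0 ∈ Set.Ioc (0 : ℝ) 1 → ∀ h : ℝ → ℂ,
      Differentiable ℝ h →
      (∀ u : ℝ, ‖h u‖ ≤ lam0 * (1 + lam0 * |u|) ^ (-(10 : ℝ))) →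
      (∀ u : ℝ, ‖deriv h u‖ ≤ lam0 ^ 2 * (1 + lam0 * |u|) ^ (-(10 : ℝ))) →
      (∫⁻ u : ℝ, (∫⁻ x : E3, ∫⁻ y : E3,
          ENNReal.ofReal (jap x ^ (-(2 : ℝ) * σ) *
            ‖(h (u + ‖x - y‖) - h u) / ((‖x - y‖ : ℝ) : ℂ)‖ ^ 2 *
            jap y ^ (-(2 : ℝ) * α))) ^ ((1 : ℝ) / 2))
        ≤ ENNReal.ofReal (C * Real.sqrt lam0) := by
  obtain ⟨q, hq1, hq2, hD⟩ := aux_double' σ α hσα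
  let W : E3 × E3 → ℝ := fun z =>
    jap z.1 ^ (-(2:ℝ) * σ) * ‖z.1 - z.2‖ ^ (-(2 - q)) * jap z.2 ^ (-(2:ℝ) * α)
  have hmj := measurable_jap
  have hW : Measurable W := by fun_prop
  have hW0 : ∀ z, 0 ≤ W z := fun z => by
    have hjx : 0 < jap z.1 := lt_of_lt_of_le one_pos (one_le_jap _)
    have hjy : 0 < jap z.2 := lt_of_lt_of_le one_pos (one_le_jap _)
    positivity
  have hD' : ∫⁻ z, ENNReal.ofReal (W z) ∂(volume.prod volume) ≠ ⊤ := by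
    rw [lintegral_prod _ hW.ennreal_ofReal.aemeasurable]
    exact hD
  set D := ∫⁻ z, ENNReal.ofReal (W z) ∂(volume.prod volume)
  set M := ∫ u : ℝ, (1 + |u|) ^ (-q) with hM
  have hM0 : 0 ≤ M := integral_nonneg fun u => by positivity
  refine ⟨M + D.toReal * (2 ^ 22 * M), ?_⟩
  rintro l ⟨hl, hl1⟩ h hd h1 h2
  have ht : Real.sqrt l ^ 2 = l := Real.sq_sqrt hl.le
  have ht0 : 0 < Real.sqrt l := Real.sqrt_pos.2 hl
  set t := Real.sqrt l with htdef
  have hsc := aux_scale_s15 l q hl hq1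
  rw [← hM] at hsc
  have hma : Measurable fun u : ℝ => ENNReal.ofReal ((1 + l * |u|) ^ (-q)) := by fun_prop
  let S : ℝ → E3 × E3 → ℝ := fun u z => (2 ^ 21 * (l * t)) *
    ((1 + l * |u|) ^ (-q) + (1 + l * |u + ‖z.1 - z.2‖|) ^ (-q))
  have hS0 : ∀ u z, 0 ≤ S u z := fun u z => by positivity
  have hSm : Measurable (Function.uncurry S) := by unfold Function.uncurry; fun_prop
  have hSi : ∀ z, ∫⁻ u, ENNReal.ofReal (S u z) = ENNReal.ofReal (2 ^ 22 * M * t) := by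
    intro z
    have e : ∀ u, ENNReal.ofReal (S u z) = ENNReal.ofReal (2 ^ 21 * (l * t)) *
        (ENNReal.ofReal ((1 + l * |u|) ^ (-q)) +
          ENNReal.ofReal ((1 + l * |u + ‖z.1 - z.2‖|) ^ (-q))) := by
      intro u
      rw [← ENNReal.ofReal_add (by positivity) (by positivity),
        ← ENNReal.ofReal_mul (by positivity)]
    simp_rw [e]
    rw [lintegral_const_mul' _ _ ENNReal.ofReal_ne_top, lintegral_add_left hma,
      lintegral_add_right_eq_self (fun u => ENNReal.ofReal ((1 + l * |u|) ^ (-q))), hsc,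
      ← ENNReal.ofReal_add (by positivity) (by positivity), ← ENNReal.ofReal_mul (by positivity)]
    congr 1
    field_simp
    ring
  have key : ∀ u : ℝ, (∫⁻ x : E3, ∫⁻ y : E3,
          ENNReal.ofReal (jap x ^ (-(2 : ℝ) * σ) *
            ‖(h (u + ‖x - y‖) - h u) / ((‖x - y‖ : ℝ) : ℂ)‖ ^ 2 *
            jap y ^ (-(2 : ℝ) * α))) ^ ((1 : ℝ) / 2) ≤
      ENNReal.ofReal (l * t) * ENNReal.ofReal ((1 + l * |u|) ^ (-q)) +
        ∫⁻ z, ENNReal.ofReal (W z) * ENNReal.ofReal (S u z) ∂(volume.prod volume) := by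
    intro u
    have hA : 0 < (l * t) * (1 + l * |u|) ^ (-q) := by positivity
    refine (aux_amgm _ _ hA).trans ?_
    rw [ENNReal.ofReal_mul (by positivity)]
    gcongr
    rw [lintegral_prod _ (by
      apply Measurable.aemeasurable
      exact hW.ennreal_ofReal.mul (hSm.comp measurable_prodMk_left).ennreal_ofReal),
      ← lintegral_const_mul' _ _ ENNReal.ofReal_ne_top]
    refine lintegral_mono fun x => ?_
    rw [← lintegral_const_mul' _ _ ENNReal.ofReal_ne_top]
    refine lintegral_mono fun y => ?_
    rw [← ENNReal.ofReal_mul (by positivity), ← ENNReal.ofReal_mul (hW0 _)]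
    apply ENNReal.ofReal_le_ofReal
    exact aux_pt l q u σ α hl hl1 hq1 hq2 h hd h1 h2 x y
  refine (lintegral_mono key).trans ?_
  rw [lintegral_add_left (hma.const_mul _), lintegral_const_mul' _ _ ENNReal.ofReal_ne_top, hsc,
    lintegral_lintegral_swap]
  · simp_rw [lintegral_const_mul' _ _ ENNReal.ofReal_ne_top, hSi]
    rw [lintegral_mul_const' _ _ ENNReal.ofReal_ne_top, ← ENNReal.ofReal_mul (by positivity)]
    change _ + D * _ ≤ _
    rw [← ENNReal.ofReal_toReal hD', ← ENNReal.ofReal_mul (by positivity),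
      ← ENNReal.ofReal_add (by positivity) (by positivity)]
    apply ENNReal.ofReal_le_ofReal
    rw [ENNReal.toReal_ofReal (by positivity)]
    apply le_of_eq
    field_simp
  · apply Measurable.aemeasurable
    exact (hW.comp measurable_snd).ennreal_ofReal.mul hSm.ennreal_ofReal
end
end
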